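/- There is a function f: ℕ → ℕ such that the following holds. Let T1, T2 be two incompatible unrooted binary phylogenetic trees with tw(D(T1,T2)) = k. If there exists a common chain C of T1 and T2 of length t > f(k), then clipping C down to length f(k) (by the common chain reduction) yields trees whose display graph D' satisfies tw(D') = tw(D(T1,T2)). -/

import Mathlib

open SimpleGraph

/-- `G` has a tree decomposition of width at most `k`: a tree `t` together with
bags satisfying (tw1), (tw2) and (tw3), all of whose bags have size at most `k+1`. -/
def HasTreeDecompWidthLE {V : Type*} (G : SimpleGraph V) (k : ℕ) : Prop :=
  ∃ (n : ℕ) (t : SimpleGraph (Fin (n + 1))) (bag : Fin (n + 1) → Finset V),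
    t.IsTree ∧
    (∀ v : V, ∃ i, v ∈ bag i) ∧
    (∀ u v : V, G.Adj u v → ∃ i, u ∈ bag i ∧ v ∈ bag i) ∧
    (∀ v : V, (t.induce {i | v ∈ bag i}).Connected) ∧
    (∀ i, (bag i).card ≤ k + 1)

/-- The treewidth of a graph: the least `k` such that `G` has a tree decomposition
of width `k`. -/
noncomputable def treewidth {V : Type*} (G : SimpleGraph V) : ℕ :=
  sInf {k | HasTreeDecompWidthLE G k}

/-- An unrooted binary phylogenetic graph (tree or network) on label set `X`:
a finite connected graph whose degree-1 vertices are bijectively labelled by `X`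
and all of whose other vertices have degree 3. -/
structure PhyloGraph (V : Type*) (X : Type*) where
  graph : SimpleGraph V
  finite : Finite V
  connected : graph.Connected
  leaf : X → V
  leaf_inj : Function.Injective leaf
  leaf_deg : ∀ x : X, (graph.neighborSet (leaf x)).ncard = 1
  internal_deg : ∀ v : V, (∀ x : X, leaf x ≠ v) → (graph.neighborSet v).ncard = 3

/-- An unrooted binary phylogenetic tree on label set `X`. -/
structure PhyloTree (V : Type*) (X : Type*) extends PhyloGraph V X where
  acyclic : graph.IsAcyclic

open Classical in
/-- The map identifying a leaf of the second graph with the leaf of the first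
graph carrying the same label. -/
noncomputable def mergeMap {V1 V2 X : Type*} (l1 : X → V1) (l2 : X → V2) :
    V1 ⊕ V2 → V1 ⊕ V2
  | Sum.inl v => Sum.inl v
  | Sum.inr w => if h : ∃ x, l2 x = w then Sum.inl (l1 h.choose) else Sum.inr w

lemma mergeMap_idem {V1 V2 X : Type*} (l1 : X → V1) (l2 : X → V2) (u : V1 ⊕ V2) :
    mergeMap l1 l2 (mergeMap l1 l2 u) = mergeMap l1 l2 u := by
  classical
  cases u with
  | inl v => rfl
  | inr w =>
    by_cases h : ∃ x, l2 x = w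
    · simp [mergeMap, h]
    · simp [mergeMap, h]

/-- The vertex set of the display graph: the disjoint union of the vertex sets
of the two graphs, with leaves carrying the same label identified. -/
def DisplayVertex {V1 V2 X : Type*} (l1 : X → V1) (l2 : X → V2) : Type _ :=
  {u : V1 ⊕ V2 // mergeMap l1 l2 u = u}

/-- The canonical map from `V1 ⊕ V2` to the vertex set of the display graph. -/
noncomputable def toDisplay {V1 V2 X : Type*} (l1 : X → V1) (l2 : X → V2) (u : V1 ⊕ V2) :
    DisplayVertex l1 l2 :=
  ⟨mergeMap l1 l2 u, mergeMap_idem l1 l2 u⟩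

/-- The display graph of two leaf-labelled graphs: their disjoint union with the
leaves carrying the same label identified. -/
noncomputable def displayGraph {V1 V2 X : Type*} (G1 : SimpleGraph V1) (l1 : X → V1)
    (G2 : SimpleGraph V2) (l2 : X → V2) : SimpleGraph (DisplayVertex l1 l2) :=
  SimpleGraph.fromRel (fun a b =>
    (∃ u v : V1, G1.Adj u v ∧ a = toDisplay l1 l2 (Sum.inl u) ∧ b = toDisplay l1 l2 (Sum.inl v)) ∨
    (∃ u v : V2, G2.Adj u v ∧ a = toDisplay l1 l2 (Sum.inr u) ∧ b = toDisplay l1 l2 (Sum.inr v)))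

/-- The treewidth distance between two phylogenetic trees:
`d_tw(T1,T2) = tw(D(T1,T2)) - 2`. -/
noncomputable def dtw {V1 V2 X : Type*} (T1 : PhyloTree V1 X) (T2 : PhyloTree V2 X) : ℕ :=
  treewidth (displayGraph T1.graph T1.leaf T2.graph T2.leaf) - 2

/-- Two phylogenetic trees are compatible if there is a label-preserving
isomorphism between them. -/
def Compatible {V1 V2 X : Type*} (T1 : PhyloTree V1 X) (T2 : PhyloTree V2 X) : Prop :=
  ∃ φ : T1.graph ≃g T2.graph, ∀ x : X, φ (T1.leaf x) = T2.leaf x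

/-- `C = (c 0, ..., c (t-1))` is a chain of `T` of length `t` with parents
`p 0, ..., p (t-1)`: the taxa are distinct, the parents are mutually distinct,
`p i` is the parent of the taxon `c i`, and `(p 0, ..., p (t-1))` is a path. -/
def PhyloChain {V X : Type*} (T : PhyloTree V X) (t : ℕ) (c : Fin t → X) (p : Fin t → V) : Prop :=
  Function.Injective c ∧ Function.Injective p ∧
  (∀ i : Fin t, T.graph.Adj (p i) (T.leaf (c i))) ∧
  (∀ (i : ℕ) (h : i + 1 < t), T.graph.Adj (p ⟨i, Nat.lt_of_succ_lt h⟩) (p ⟨i + 1, h⟩))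

/-- The indices of the taxa of a chain of length `t` kept by the common
`d`-chain reduction: the first `⌈d/2⌉` and the last `⌊d/2⌋` ones. -/
def keepIdx (t d : ℕ) (i : Fin t) : Prop :=
  (i : ℕ) < (d + 1) / 2 ∨ t - d / 2 ≤ (i : ℕ)

/-- `T'` is obtained from `T` by the common `d`-chain reduction applied to the
chain `c` (with parents `p`) of length `t`: the first `⌈d/2⌉` and last `⌊d/2⌋`
taxa of the chain are kept, the intermediate taxa are deleted, the resulting
degree-2 vertices are suppressed (so that the parents of the taxa
`c (⌈d/2⌉ - 1)` and `c (t - ⌊d/2⌋)` become adjacent) and resulting unlabelled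
degree-1 vertices are deleted. -/
def IsClippedChain {V X W : Type*} (T : PhyloTree V X) (t : ℕ) (c : Fin t → X)
    (p : Fin t → V) (d : ℕ)
    (T' : PhyloTree W {x : X // ∀ i : Fin t, ¬ keepIdx t d i → c i ≠ x}) : Prop :=
  ∃ φ : W → V,
    Function.Injective φ ∧
    (∀ y, φ (T'.leaf y) = T.leaf y.1) ∧
    Set.range φ = {v | ∀ i : Fin t, ¬ keepIdx t d i → (T.leaf (c i) ≠ v ∧ p i ≠ v)} ∧
    ∀ a b : W, T'.graph.Adj a b ↔
      (T.graph.Adj (φ a) (φ b) ∨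
        ∃ (h1 : (d + 1) / 2 - 1 < t) (h2 : t - d / 2 < t),
          ((φ a = p ⟨(d + 1) / 2 - 1, h1⟩ ∧ φ b = p ⟨t - d / 2, h2⟩) ∨
           (φ b = p ⟨(d + 1) / 2 - 1, h1⟩ ∧ φ a = p ⟨t - d / 2, h2⟩)))

/-- The vertices of the display graph that are taxa of the common chain `c`. -/
noncomputable def chainTaxaV {V1 V2 X : Type*} (T1 : PhyloTree V1 X) (T2 : PhyloTree V2 X)
    (t : ℕ) (c : Fin t → X) : Set (DisplayVertex T1.leaf T2.leaf) :=
  {u | ∃ i : Fin t, u = toDisplay T1.leaf T2.leaf (Sum.inl (T1.leaf (c i)))}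

/-- The vertex set of the `2 × t` grid `g(C)` of a common chain in the display
graph: the parents of the chain taxa in both trees. -/
noncomputable def gridV {V1 V2 X : Type*} (T1 : PhyloTree V1 X) (T2 : PhyloTree V2 X)
    (t : ℕ) (p : Fin t → V1) (q : Fin t → V2) : Set (DisplayVertex T1.leaf T2.leaf) :=
  {u | ∃ i : Fin t, u = toDisplay T1.leaf T2.leaf (Sum.inl (p i)) ∨
    u = toDisplay T1.leaf T2.leaf (Sum.inr (q i))}

/-- The display graph of `T1` and `T2` in which the degree-2 vertices labelled
by the taxa of the common chain `c` have been suppressed (turning the parents of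
each chain taxon in the two trees into neighbours). -/
noncomputable def chainSuppressedDisplay {V1 V2 X : Type*} (T1 : PhyloTree V1 X)
    (T2 : PhyloTree V2 X) (t : ℕ) (c : Fin t → X) (p : Fin t → V1) (q : Fin t → V2) :
    SimpleGraph {u : DisplayVertex T1.leaf T2.leaf // u ∉ chainTaxaV T1 T2 t c} :=
  SimpleGraph.fromRel (fun a b =>
    (displayGraph T1.graph T1.leaf T2.graph T2.leaf).Adj a.1 b.1 ∨
    ∃ i : Fin t, a.1 = toDisplay T1.leaf T2.leaf (Sum.inl (p i)) ∧
      b.1 = toDisplay T1.leaf T2.leaf (Sum.inr (q i)))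

/-- The grid `g(C)` of the common chain `c` is a separator of the display graph
of `T1` and `T2`: deleting the grid vertices (from the display graph with the
chain taxa suppressed) disconnects it. -/
noncomputable def GridSeparates {V1 V2 X : Type*} (T1 : PhyloTree V1 X) (T2 : PhyloTree V2 X)
    (t : ℕ) (c : Fin t → X) (p : Fin t → V1) (q : Fin t → V2) : Prop :=
  ¬ ((chainSuppressedDisplay T1 T2 t c p q).induce
      {w : {u : DisplayVertex T1.leaf T2.leaf // u ∉ chainTaxaV T1 T2 t c} |
        w.1 ∉ gridV T1 T2 t p q}).Preconnected

/-! ### Part 1: an inductive presentation of tree decompositions -/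

section DecSection

open Classical

/-- An inductive presentation of (the set of bags of) tree decompositions of width `≤ w`. -/
inductive Dec {V : Type*} (w : ℕ) : Set (Finset V) → Prop
  | single (B : Finset V) (h : B.card ≤ w + 1) : Dec w {B}
  | glue (A B : Set (Finset V)) (P Q : Finset V) (hA : Dec w A) (hB : Dec w B)
      (hP : P ∈ A) (hQ : Q ∈ B)
      (h : ∀ v, (∃ E ∈ A, v ∈ E) → (∃ E ∈ B, v ∈ E) → v ∈ P ∧ v ∈ Q)
      (hc : (P ∩ Q).card ≤ w) : Dec w (A ∪ B)

/-- Connectedness of a set of nodes, in terms of cuts. -/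
def CutConn {ι : Type*} (t : SimpleGraph ι) (K : Set ι) : Prop :=
  ∀ (s : Set ι) (x y : ι), x ∈ K → x ∈ s → y ∈ K → y ∉ s →
    ∃ i j, i ∈ K ∧ i ∈ s ∧ j ∈ K ∧ j ∉ s ∧ t.Adj i j

lemma cutConn_iff {ι : Type*} (t : SimpleGraph ι) (K : Set ι) :
    CutConn t K ↔ (t.induce K).Preconnected := by
  constructor
  · rintro h ⟨x, hx⟩ ⟨y, hy⟩
    by_contra hn
    obtain ⟨i, j, hi, ⟨hi', hr⟩, hj, hjs, hij⟩ :=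
      h {z | ∃ hz : z ∈ K, (t.induce K).Reachable ⟨x, hx⟩ ⟨z, hz⟩} x y hx ⟨hx, by rfl⟩ hy
        (by rintro ⟨_, h⟩; exact hn h)
    apply hjs
    refine ⟨hj, hr.trans (Adj.reachable ?_)⟩
    exact hij
  · intro h s x y hx hxs hy hys
    obtain ⟨p⟩ := h ⟨x, hx⟩ ⟨y, hy⟩
    obtain ⟨d, -, h1, h2⟩ := p.exists_boundary_dart {z | z.1 ∈ s} hxs hys
    exact ⟨d.fst.1, d.snd.1, d.fst.2, h1, d.snd.2, h2, d.adj⟩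

lemma tree_to_dec {V : Type*} (w : ℕ) : ∀ (n : ℕ) (ι : Type) [Fintype ι] (t : SimpleGraph ι)
    (bag : ι → Finset V), Fintype.card ι = n + 1 → t.IsTree →
    (∀ v, CutConn t {i | v ∈ bag i}) → (∀ i, (bag i).card ≤ w + 1) →
    ∃ B : Set (Finset V), Dec w B ∧ (∀ i, ∃ E ∈ B, bag i ⊆ E) ∧
      (∀ E ∈ B, ∀ v ∈ E, ∃ i, v ∈ bag i) := by
  intro n
  induction n with
  | zero =>
    intro ι _ t bag hn ht hc hw
    obtain ⟨i, hi⟩ := Fintype.card_eq_one_iff.mp hn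
    refine ⟨{bag i}, Dec.single _ (hw i), ?_, ?_⟩
    · intro j; rw [hi j]; exact ⟨_, rfl, Finset.Subset.refl _⟩
    · rintro E rfl v hv; exact ⟨i, hv⟩
  | succ n ih =>
    intro ι _ t bag hn ht hc hw
    have : Nontrivial ι := Fintype.one_lt_card_iff_nontrivial.mp (by omega)
    obtain ⟨l, hl⟩ := ht.exists_vert_degree_one_of_nontrivial
    have hconn := ht.connected.induce_compl_singleton_of_degree_eq_one hl
    obtain ⟨p, hp, hpu⟩ := degree_eq_one_iff_existsUnique_adj.mp hl
    have hpl : p ≠ l := fun h => by subst h; exact t.loopless.irrefl _ hp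
    have key : ∀ v, v ∈ bag l → ∀ i, i ≠ l → v ∈ bag i → v ∈ bag p := by
      intro v hv i hi hvi
      obtain ⟨a, b, ha, has, hb, hbs, hab⟩ := hc v {l} l i hv rfl hvi hi
      have : a = l := has
      subst this
      rw [← hpu b hab]; exact hb
    obtain ⟨B, hB, h1, h2⟩ := ih ({l}ᶜ : Set ι) (t.induce {l}ᶜ) (fun i => bag i.1)
      (by rw [Fintype.card_compl_set]; simp [hn])
      ⟨hconn, ht.isAcyclic.induce _⟩
      (by
        intro v s x y hx hxs hy hys
        by_cases hps : (⟨p, hpl⟩ : ({l}ᶜ : Set ι)) ∈ s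
        · obtain ⟨a, b, ha, has, hb, hbs, hab⟩ := hc v (insert l (Subtype.val '' s)) x.1 y.1 hx
            (Or.inr ⟨x, hxs, rfl⟩) hy (by
              rintro (h | ⟨z, hz, hzy⟩)
              · exact y.2 h
              · exact hys ((Subtype.ext hzy : z = y) ▸ hz))
          have hbl : b ≠ l := fun h => hbs (Or.inl h)
          have hal : a ≠ l := by
            rintro rfl
            apply hbs; right
            exact ⟨⟨p, hpl⟩, hps, (hpu b hab).symm⟩
          refine ⟨⟨a, hal⟩, ⟨b, hbl⟩, ha, ?_, hb, ?_, hab⟩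
          · rcases has with h | ⟨z, hz, hzy⟩
            · exact absurd h hal
            · exact (Subtype.ext hzy : z = ⟨a, hal⟩) ▸ hz
          · intro h; exact hbs (Or.inr ⟨_, h, rfl⟩)
        · obtain ⟨a, b, ha, has, hb, hbs, hab⟩ := hc v (Subtype.val '' s) x.1 y.1 hx
            ⟨x, hxs, rfl⟩ hy (by
              rintro ⟨z, hz, hzy⟩
              exact hys ((Subtype.ext hzy : z = y) ▸ hz))
          obtain ⟨a', ha', rfl⟩ := has
          have hbl : b ≠ l := by
            rintro rfl
            have : a'.1 = p := hpu _ hab.symm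
            exact hps ((Subtype.ext this : a' = ⟨p, hpl⟩) ▸ ha')
          exact ⟨a', ⟨b, hbl⟩, ha, ha', hb, fun h => hbs ⟨_, h, rfl⟩, hab⟩)
      (fun i => hw i.1)
    obtain ⟨P, hP, hpP⟩ := h1 ⟨p, hpl⟩
    by_cases hsub : bag l ⊆ bag p
    · refine ⟨B, hB, ?_, ?_⟩
      · intro i
        by_cases hi : i = l
        · subst hi; exact ⟨P, hP, hsub.trans hpP⟩
        · exact h1 ⟨i, hi⟩
      · intro E hE v hv
        obtain ⟨i, hi⟩ := h2 E hE v hv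
        exact ⟨i.1, hi⟩
    · refine ⟨B ∪ {bag l}, Dec.glue B {bag l} P (bag l) hB (Dec.single _ (hw l)) hP rfl ?_ ?_, ?_, ?_⟩
      · rintro v ⟨E, hE, hvE⟩ ⟨_, rfl, hv⟩
        obtain ⟨i, hi⟩ := h2 E hE v hvE
        exact ⟨hpP (key v hv i.1 i.2 hi), hv⟩
      · obtain ⟨v, hv, hvp⟩ := Finset.not_subset.mp hsub
        have : (P ∩ bag l) ⊂ bag l := by
          refine Finset.ssubset_iff_subset_ne.mpr ⟨Finset.inter_subset_right, fun h => ?_⟩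
          rw [← h] at hv
          have hvP := (Finset.mem_inter.mp hv).1
          obtain ⟨i, hi⟩ := h2 P hP v hvP
          exact hvp (key v (Finset.mem_inter.mp hv).2 i.1 i.2 hi)
        have := Finset.card_lt_card this
        have := hw l
        omega
      · intro i
        by_cases hi : i = l
        · subst hi; exact ⟨_, Or.inr rfl, Finset.Subset.refl _⟩
        · obtain ⟨E, hE, h⟩ := h1 ⟨i, hi⟩
          exact ⟨E, Or.inl hE, h⟩
      · rintro E (hE | rfl) v hv
        · obtain ⟨i, hi⟩ := h2 E hE v hv
          exact ⟨i.1, hi⟩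
        · exact ⟨l, hv⟩

lemma isAcyclic_sum {α β : Type*} {G : SimpleGraph α} {H : SimpleGraph β}
    (hG : G.IsAcyclic) (hH : H.IsAcyclic) : (G ⊕g H).IsAcyclic := by
  rw [isAcyclic_iff_forall_adj_isBridge] at *
  rintro (u | u) (v | v) huv
  · rw [isBridge_iff]
    have hb := hG (sum_adj_inl.mp huv)
    rw [isBridge_iff] at hb
    rintro ⟨p⟩
    obtain ⟨d, -, ⟨x, hx, hxd⟩, h2⟩ := p.exists_boundary_dart
      (Sum.inl '' {x | (G.deleteEdges {s(u, v)}).Reachable u x}) ⟨u, by exact Reachable.refl u, rfl⟩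
      (by rintro ⟨y, hy, h⟩; cases h; exact hb hy)
    apply h2
    have had := d.adj
    rw [← hxd] at had
    rcases hd : d.snd with y | y
    · rw [hd] at had
      refine ⟨y, Reachable.trans hx (Adj.reachable ?_), rfl⟩
      simpa using had
    · rw [hd] at had; simp at had
  · simp at huv
  · simp at huv
  · rw [isBridge_iff]
    have hb := hH (sum_adj_inr.mp huv)
    rw [isBridge_iff] at hb
    rintro ⟨p⟩
    obtain ⟨d, -, ⟨x, hx, hxd⟩, h2⟩ := p.exists_boundary_dart
      (Sum.inr '' {x | (H.deleteEdges {s(u, v)}).Reachable u x}) ⟨u, by exact Reachable.refl u, rfl⟩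
      (by rintro ⟨y, hy, h⟩; cases h; exact hb hy)
    apply h2
    have had := d.adj
    rw [← hxd] at had
    rcases hd : d.snd with y | y
    · rw [hd] at had; simp at had
    · rw [hd] at had
      refine ⟨y, Reachable.trans hx (Adj.reachable ?_), rfl⟩
      simpa using had

lemma dec_to_tree {V : Type*} {w : ℕ} {B : Set (Finset V)} (hB : Dec w B) :
    ∃ (ι : Type) (_ : Fintype ι) (t : SimpleGraph ι) (bag : ι → Finset V), t.IsTree ∧
      (∀ i, bag i ∈ B) ∧ (∀ E ∈ B, ∃ i, bag i = E) ∧ (∀ i, (bag i).card ≤ w + 1) ∧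
      ∀ v, CutConn t {i | v ∈ bag i} := by
  induction hB with
  | single B h =>
    refine ⟨Unit, inferInstance, ⊥, fun _ => B, IsTree.of_subsingleton, fun _ => rfl, ?_, fun _ => h, ?_⟩
    · rintro E rfl; exact ⟨(), rfl⟩
    · intro v s x y _ hx _ hy
      exact absurd hx hy
  | glue A B P Q hA hB hP hQ h hc ihA ihB =>
    obtain ⟨ι, _, t, bag, ht, h1, h2, h3, h4⟩ := ihA
    obtain ⟨κ, _, u, bag', ht', h1', h2', h3', h4'⟩ := ihB
    obtain ⟨a, ha⟩ := h2 P hP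
    obtain ⟨b, hb⟩ := h2' Q hQ
    refine ⟨ι ⊕ κ, inferInstance, t.sum u ⊔ edge (.inl a) (.inr b), Sum.elim bag bag', ⟨?_, ?_⟩,
      ?_, ?_, ?_, ?_⟩
    · exact ht.connected.sum_sup_edge ht'.connected
    · exact (isAcyclic_sum ht.isAcyclic ht'.isAcyclic).sup_edge_of_not_reachable
        (not_reachable_sum_inl_inr _ _)
    · rintro (i | i)
      · exact Or.inl (h1 i)
      · exact Or.inr (h1' i)
    · rintro E (hE | hE)
      · obtain ⟨i, hi⟩ := h2 E hE; exact ⟨.inl i, hi⟩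
      · obtain ⟨i, hi⟩ := h2' E hE; exact ⟨.inr i, hi⟩
    · rintro (i | i)
      · exact h3 i
      · exact h3' i
    · intro v s x y hx hxs hy hys
      by_cases c1 : ∃ i j, v ∈ bag i ∧ v ∈ bag j ∧ Sum.inl i ∈ s ∧ Sum.inl j ∉ s
      · obtain ⟨i, j, hi, hj, his, hjs⟩ := c1
        obtain ⟨i, j, hi, his, hj, hjs, hij⟩ := h4 v {z | Sum.inl z ∈ s} i j hi his hj hjs
        exact ⟨.inl i, .inl j, hi, his, hj, hjs, Or.inl (by simpa using hij)⟩
      by_cases c2 : ∃ i j, v ∈ bag' i ∧ v ∈ bag' j ∧ Sum.inr i ∈ s ∧ Sum.inr j ∉ s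
      · obtain ⟨i, j, hi, hj, his, hjs⟩ := c2
        obtain ⟨i, j, hi, his, hj, hjs, hij⟩ := h4' v {z | Sum.inr z ∈ s} i j hi his hj hjs
        exact ⟨.inr i, .inr j, hi, his, hj, hjs, Or.inl (by simpa using hij)⟩
      push Not at c1 c2
      rcases x with x | x <;> rcases y with y | y
      · exact absurd (c1 x y hx hy hxs) hys
      · have := h v ⟨_, h1 x, hx⟩ ⟨_, h1' y, hy⟩
        refine ⟨.inl a, .inr b, ?_, c1 x a hx (ha ▸ this.1) hxs, ?_, fun hbs => ?_, ?_⟩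
        · show v ∈ bag a
          rw [ha]; exact this.1
        · show v ∈ bag' b
          rw [hb]; exact this.2
        · exact hys (c2 b y (hb ▸ this.2) hy hbs)
        · simp [edge_adj]
      · have := h v ⟨_, h1 y, hy⟩ ⟨_, h1' x, hx⟩
        refine ⟨.inr b, .inl a, ?_, c2 x b hx (hb ▸ this.2) hxs, ?_, fun hbs => ?_, ?_⟩
        · show v ∈ bag' b
          rw [hb]; exact this.2
        · show v ∈ bag a
          rw [ha]; exact this.1
        · exact hys (c1 a y (ha ▸ this.1) hy hbs)
        · simp [edge_adj]
      · exact absurd (c2 x y hx hy hxs) hys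

/-- `B` covers the vertices and edges of `G`. -/
def Covers {V : Type*} (G : SimpleGraph V) (B : Set (Finset V)) : Prop :=
  (∀ v, ∃ E ∈ B, v ∈ E) ∧ ∀ u v, G.Adj u v → ∃ E ∈ B, u ∈ E ∧ v ∈ E

lemma hasTD_iff {V : Type*} (G : SimpleGraph V) (w : ℕ) :
    HasTreeDecompWidthLE G w ↔ ∃ B : Set (Finset V), Dec w B ∧ Covers G B := by
  constructor
  · rintro ⟨n, t, bag, ht, h1, h2, h3, h4⟩
    obtain ⟨B, hB, hb, -⟩ := tree_to_dec w n (Fin (n + 1)) t bag (by simp) ht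
      (fun v => (cutConn_iff _ _).mpr (h3 v).preconnected) h4
    refine ⟨B, hB, ?_, ?_⟩
    · intro v
      obtain ⟨i, hi⟩ := h1 v
      obtain ⟨E, hE, hs⟩ := hb i
      exact ⟨E, hE, hs hi⟩
    · intro u v huv
      obtain ⟨i, hi, hi'⟩ := h2 u v huv
      obtain ⟨E, hE, hs⟩ := hb i
      exact ⟨E, hE, hs hi, hs hi'⟩
  · rintro ⟨B, hB, h1, h2⟩
    obtain ⟨ι, _, t, bag, ht, g1, g2, g3, g4⟩ := dec_to_tree hB
    have := ht.connected.nonempty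
    obtain ⟨n, hn⟩ : ∃ n, Fintype.card ι = n + 1 :=
      ⟨Fintype.card ι - 1, by have := Fintype.card_pos (α := ι); omega⟩
    let e : Fin (n + 1) ≃ ι := (Fintype.equivFinOfCardEq hn).symm
    refine ⟨n, t.comap e, bag ∘ e, ?_, ?_, ?_, ?_, fun i => g3 _⟩
    · exact (Iso.isTree_iff (Iso.comap e t)).mpr ht
    · intro v
      obtain ⟨E, hE, hv⟩ := h1 v
      obtain ⟨i, rfl⟩ := g2 E hE
      exact ⟨e.symm i, by simpa using hv⟩
    · intro u v huv
      obtain ⟨E, hE, hu, hv⟩ := h2 u v huv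
      obtain ⟨i, rfl⟩ := g2 E hE
      exact ⟨e.symm i, by simpa using hu, by simpa using hv⟩
    · intro v
      have hp : ((t.comap e).induce {i | v ∈ (bag ∘ e) i}).Preconnected := by
        rw [← cutConn_iff]
        intro s x y hx hxs hy hys
        obtain ⟨i, j, hi, his, hj, hjs, hij⟩ := g4 v (e.symm ⁻¹' s) (e x) (e y) hx
          (by simpa using hxs) hy (by simpa using hys)
        exact ⟨e.symm i, e.symm j, by simpa using hi, his, by simpa using hj, hjs, by simpa using hij⟩
      obtain ⟨E, hE, hv⟩ := h1 v
      obtain ⟨i, rfl⟩ := g2 E hE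
      have : Nonempty {i | v ∈ (bag ∘ e) i} := ⟨⟨e.symm i, by simpa using hv⟩⟩
      exact ⟨hp⟩

end DecSection

/-! ### Part 2: splitting, contracting and extending decompositions -/

section SplitSection

open Classical

/-- The vertex `v` lies in some bag of `B`. -/
def Un {V : Type*} (B : Set (Finset V)) (v : V) : Prop := ∃ E ∈ B, v ∈ E

/-- The vertices `u`, `v` share a bag of `B`. -/
def Share {V : Type*} (B : Set (Finset V)) (u v : V) : Prop := ∃ E ∈ B, u ∈ E ∧ v ∈ E

lemma Share.symm {V : Type*} {B : Set (Finset V)} {u v : V} (h : Share B u v) : Share B v u := by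
  obtain ⟨E, hE, h1, h2⟩ := h
  exact ⟨E, hE, h2, h1⟩

lemma Share.mono {V : Type*} {B B' : Set (Finset V)} (hB : B ⊆ B') {u v : V} (h : Share B u v) :
    Share B' u v := by
  obtain ⟨E, hE, h1⟩ := h
  exact ⟨E, hB hE, h1⟩

lemma Share.un {V : Type*} {B : Set (Finset V)} {u v : V} (h : Share B u v) : Un B u := by
  obtain ⟨E, hE, h1, _⟩ := h
  exact ⟨E, hE, h1⟩

/-- A set of vertices is connected with respect to a set of bags. -/
def BConn {V : Type*} (B : Set (Finset V)) (C : Set V) : Prop :=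
  ∀ (s : Set V) (x y : V), x ∈ C → x ∈ s → Un B x → y ∈ C → y ∉ s → Un B y →
    ∃ E ∈ B, ∃ u v, u ∈ E ∧ v ∈ E ∧ u ∈ C ∧ v ∈ C ∧ u ∈ s ∧ v ∉ s

lemma BConn.of_subsingleton {V : Type*} (B : Set (Finset V)) (C : Set V)
    (h : ∀ x ∈ C, ∀ y ∈ C, x = y) : BConn B C := by
  intro s x y hx hxs _ hy hys _
  exact absurd (h x hx y hy ▸ hxs) hys

lemma BConn.insert {V : Type*} {B : Set (Finset V)} {C : Set V} (h : BConn B C) {x y : V}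
    (hx : x ∈ C) (hxy : Share B x y) : BConn B (insert y C) := by
  intro s p q hp hps hpu hq hqs hqu
  obtain ⟨E, hE, hxE, hyE⟩ := hxy
  have lift : (∃ E ∈ B, ∃ u v, u ∈ E ∧ v ∈ E ∧ u ∈ C ∧ v ∈ C ∧ u ∈ s ∧ v ∉ s) →
      ∃ E ∈ B, ∃ u v, u ∈ E ∧ v ∈ E ∧ u ∈ Insert.insert y C ∧ v ∈ Insert.insert y C ∧
        u ∈ s ∧ v ∉ s := by
    rintro ⟨E, hE, u, v, h1, h2, h3, h4, h5⟩
    exact ⟨E, hE, u, v, h1, h2, Or.inr h3, Or.inr h4, h5⟩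
  by_cases hxs : x ∈ s
  · rcases hq with rfl | hq
    · exact ⟨E, hE, x, q, hxE, hyE, Or.inr hx, Or.inl rfl, hxs, hqs⟩
    · exact lift (h s x q hx hxs ⟨E, hE, hxE⟩ hq hqs hqu)
  · rcases hp with rfl | hp
    · exact ⟨E, hE, p, x, hyE, hxE, Or.inl rfl, Or.inr hx, hps, hxs⟩
    · exact lift (h s p x hp hps hpu hx hxs ⟨E, hE, hxE⟩)

/-- The condition under which two decompositions can be glued. -/
structure Glu {V : Type*} (w : ℕ) (A B : Set (Finset V)) (P Q : Finset V) : Prop where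
  decA : Dec w A
  decB : Dec w B
  hP : P ∈ A
  hQ : Q ∈ B
  inter : ∀ v, Un A v → Un B v → v ∈ P ∧ v ∈ Q
  card : (P ∩ Q).card ≤ w

lemma Glu.dec {V : Type*} {w : ℕ} {A B : Set (Finset V)} {P Q : Finset V} (h : Glu w A B P Q) :
    Dec w (A ∪ B) :=
  Dec.glue A B P Q h.decA h.decB h.hP h.hQ h.inter h.card

lemma Glu.symm {V : Type*} {w : ℕ} {A B : Set (Finset V)} {P Q : Finset V} (h : Glu w A B P Q) :
    Glu w B A Q P :=
  ⟨h.decB, h.decA, h.hQ, h.hP, fun v h1 h2 => (h.inter v h2 h1).symm,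
    by rw [Finset.inter_comm]; exact h.card⟩

lemma un_union {V : Type*} {A B : Set (Finset V)} {v : V} : Un (A ∪ B) v ↔ Un A v ∨ Un B v := by
  constructor
  · rintro ⟨E, hE | hE, hv⟩
    · exact Or.inl ⟨E, hE, hv⟩
    · exact Or.inr ⟨E, hE, hv⟩
  · rintro (⟨E, hE, hv⟩ | ⟨E, hE, hv⟩)
    · exact ⟨E, Or.inl hE, hv⟩
    · exact ⟨E, Or.inr hE, hv⟩

lemma BConn.meets {V : Type*} {A B : Set (Finset V)} {P Q : Finset V}
    (h : ∀ v, Un A v → Un B v → v ∈ P ∧ v ∈ Q) {C : Set V} (hC : BConn (A ∪ B) C)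
    {x y : V} (hx : x ∈ C) (hxA : Un A x) (hy : y ∈ C) (hyB : Un B y) :
    ∃ z ∈ C, z ∈ P ∧ z ∈ Q := by
  by_cases hyA : Un A y
  · exact ⟨y, hy, h y hyA hyB⟩
  · obtain ⟨E, hE, u, v, hu, hv, huC, hvC, hus, hvs⟩ :=
      hC {z | Un A z} x y hx hxA (un_union.mpr (Or.inl hxA)) hy hyA (un_union.mpr (Or.inr hyB))
    rcases hE with hE | hE
    · exact absurd ⟨E, hE, hv⟩ hvs
    · exact ⟨u, huC, h u hus ⟨E, hE, hu⟩⟩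

lemma BConn.left {V : Type*} {A B : Set (Finset V)} {P Q : Finset V} (hP : P ∈ A)
    (h : ∀ v, Un A v → Un B v → v ∈ P ∧ v ∈ Q) {C : Set V} (hC : BConn (A ∪ B) C) :
    BConn A C := by
  intro s x y hx hxs hxu hy hys hyu
  by_contra hn
  by_cases hcase : ∃ z ∈ C, z ∈ P ∧ z ∈ s
  · obtain ⟨z, hzC, hzP, hzs⟩ := hcase
    obtain ⟨E, hE, u, v, hu, hv, huC, hvC, hus, hvs⟩ :=
      hC {z | z ∉ s ∧ Un A z} y x hy ⟨hys, hyu⟩ (un_union.mpr (Or.inl hyu)) hx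
        (fun h => h.1 hxs) (un_union.mpr (Or.inl hxu))
    rcases hE with hE | hE
    · have : v ∈ s := by
        by_contra hvn
        exact hvs ⟨hvn, E, hE, hv⟩
      exact hn ⟨E, hE, v, u, hv, hu, hvC, huC, this, hus.1⟩
    · exact hn ⟨P, hP, z, u, hzP, (h u hus.2 ⟨E, hE, hu⟩).1, hzC, huC, hzs, hus.1⟩
  · push Not at hcase
    obtain ⟨E, hE, u, v, hu, hv, huC, hvC, hus, hvs⟩ :=
      hC {z | z ∈ s ∧ Un A z} x y hx ⟨hxs, hxu⟩ (un_union.mpr (Or.inl hxu)) hy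
        (fun h => hys h.1) (un_union.mpr (Or.inl hyu))
    rcases hE with hE | hE
    · have : v ∉ s := fun hvn => hvs ⟨hvn, E, hE, hv⟩
      exact hn ⟨E, hE, u, v, hu, hv, huC, hvC, hus.1, this⟩
    · exact hcase u huC (h u hus.2 ⟨E, hE, hu⟩).1 hus.1

/-- The conclusion of the splitting lemma. -/
def SplitsAt {V : Type*} (w : ℕ) (B : Set (Finset V)) (L R : Set (Set V)) : Prop :=
  ∃ C ∈ L, ∃ D ∈ R, ∃ A1 A2 P Q, Glu w A1 A2 P Q ∧ B = A1 ∪ A2 ∧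
    (∀ x ∈ C, ¬ Un A2 x) ∧ (∀ x ∈ D, ¬ Un A1 x)

lemma split_lift {V : Type*} {w : ℕ} {A B : Set (Finset V)} {P Q : Finset V}
    (hg : Glu w A B P Q) {L R : Set (Set V)}
    (hL : ∀ C ∈ L, BConn (A ∪ B) C) (hR : ∀ C ∈ R, BConn (A ∪ B) C)
    (hLA : ∀ C ∈ L, ∃ x ∈ C, Un A x) (hRA : ∀ C ∈ R, ∃ x ∈ C, Un A x)
    (hs : SplitsAt w A L R) : SplitsAt w (A ∪ B) L R := by
  obtain ⟨C, hC, D, hD, A1, A2, P', Q', hg', rfl, hC2, hD1⟩ := hs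
  rcases hg.hP with hP | hP
  · refine ⟨C, hC, D, hD, A1 ∪ B, A2, P', Q', ⟨?_, hg'.decB, Or.inl hg'.hP, hg'.hQ, ?_, hg'.card⟩,
      ?_, hC2, ?_⟩
    · refine Dec.glue A1 B P Q hg'.decA hg.decB hP hg.hQ ?_ hg.card
      intro v h1 h2
      exact hg.inter v (un_union.mpr (Or.inl h1)) h2
    · intro v h1 h2
      rcases un_union.mp h1 with h1 | h1
      · exact hg'.inter v h1 h2
      · have := (hg.inter v (un_union.mpr (Or.inr h2)) h1).1
        exact hg'.inter v ⟨P, hP, this⟩ h2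
    · rw [Set.union_right_comm]
    · intro x hx h
      rcases un_union.mp h with h | h
      · exact hD1 x hx h
      · obtain ⟨y, hy, hyA⟩ := hRA D hD
        obtain ⟨z, hz, hzP, -⟩ := BConn.meets hg.inter (hR D hD) hy hyA hx h
        exact hD1 z hz ⟨P, hP, hzP⟩
  · refine ⟨C, hC, D, hD, A1, A2 ∪ B, P', Q', ⟨hg'.decA, ?_, hg'.hP, Or.inl hg'.hQ, ?_, hg'.card⟩,
      ?_, ?_, hD1⟩
    · refine Dec.glue A2 B P Q hg'.decB hg.decB hP hg.hQ ?_ hg.card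
      intro v h1 h2
      exact hg.inter v (un_union.mpr (Or.inr h1)) h2
    · intro v h2 h1
      rcases un_union.mp h1 with h1 | h1
      · exact hg'.inter v h2 h1
      · have := (hg.inter v (un_union.mpr (Or.inl h2)) h1).1
        exact hg'.inter v h2 ⟨P, hP, this⟩
    · rw [Set.union_assoc]
    · intro x hx h
      rcases un_union.mp h with h | h
      · exact hC2 x hx h
      · obtain ⟨y, hy, hyA⟩ := hLA C hC
        obtain ⟨z, hz, hzP, -⟩ := BConn.meets hg.inter (hL C hC) hy hyA hx h
        exact hC2 z hz ⟨P, hP, hzP⟩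

lemma split_half {V : Type*} {w : ℕ} {A B : Set (Finset V)} {P Q : Finset V}
    (hg : Glu w A B P Q) {L R : Set (Set V)}
    (hL : ∀ C ∈ L, BConn (A ∪ B) C ∧ ∃ x ∈ C, Un (A ∪ B) x)
    (hR : ∀ C ∈ R, BConn (A ∪ B) C ∧ ∃ x ∈ C, Un (A ∪ B) x)
    (hLB : ∀ E ∈ A ∪ B, ∃ C ∈ L, ∀ x ∈ C, x ∉ E) (hRB : ∀ E ∈ A ∪ B, ∃ C ∈ R, ∀ x ∈ C, x ∉ E)
    (ih : (∀ C ∈ L, BConn A C ∧ ∃ x ∈ C, Un A x) → (∀ C ∈ R, BConn A C ∧ ∃ x ∈ C, Un A x) →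
      (∀ E ∈ A, ∃ C ∈ L, ∀ x ∈ C, x ∉ E) → (∀ E ∈ A, ∃ C ∈ R, ∀ x ∈ C, x ∉ E) →
      SplitsAt w A L R)
    (C0 D0 : Set V) (hC0 : C0 ∈ L) (hD0 : D0 ∈ R) (hC0B : ∀ x ∈ C0, ¬ Un B x)
    (hD0B : ∀ x ∈ D0, ¬ Un B x) : SplitsAt w (A ∪ B) L R := by
  by_cases h1 : ∃ C ∈ L, ∀ x ∈ C, ¬ Un A x
  · obtain ⟨C, hC, h⟩ := h1
    exact ⟨C, hC, D0, hD0, B, A, Q, P, hg.symm, Set.union_comm _ _, h, hD0B⟩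
  by_cases h2 : ∃ D ∈ R, ∀ x ∈ D, ¬ Un A x
  · obtain ⟨D, hD, h⟩ := h2
    exact ⟨C0, hC0, D, hD, A, B, P, Q, hg, rfl, hC0B, h⟩
  push Not at h1 h2
  refine split_lift hg (fun C hC => (hL C hC).1) (fun C hC => (hR C hC).1) h1 h2 (ih ?_ ?_ ?_ ?_)
  · exact fun C hC => ⟨BConn.left hg.hP hg.inter (hL C hC).1, h1 C hC⟩
  · exact fun C hC => ⟨BConn.left hg.hP hg.inter (hR C hC).1, h2 C hC⟩
  · exact fun E hE => hLB E (Or.inl hE)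
  · exact fun E hE => hRB E (Or.inl hE)

lemma split_dec {V : Type*} {w : ℕ} {B : Set (Finset V)} (hB : Dec w B) (L R : Set (Set V)) :
    (∀ C ∈ L, BConn B C ∧ ∃ x ∈ C, Un B x) → (∀ C ∈ R, BConn B C ∧ ∃ x ∈ C, Un B x) →
    (∀ E ∈ B, ∃ C ∈ L, ∀ x ∈ C, x ∉ E) → (∀ E ∈ B, ∃ C ∈ R, ∀ x ∈ C, x ∉ E) →
    SplitsAt w B L R := by
  induction hB with
  | single B h =>
    intro hL hR hLB hRB
    obtain ⟨C, hC, hCB⟩ := hLB B rfl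
    obtain ⟨-, x, hx, E, rfl, hxE⟩ := hL C hC
    exact absurd hxE (hCB x hx)
  | glue A B P Q hA hB hP hQ h hc ihA ihB =>
    intro hL hR hLB hRB
    have hg : Glu w A B P Q := ⟨hA, hB, hP, hQ, h, hc⟩
    have side : ∀ C, BConn (A ∪ B) C → (∀ x ∈ C, x ∉ P) →
        (∀ x ∈ C, ¬ Un A x) ∨ (∀ x ∈ C, ¬ Un B x) := by
      intro C hC hCP
      by_contra hn
      push Not at hn
      obtain ⟨⟨x, hx, hxA⟩, y, hy, hyB⟩ := hn
      obtain ⟨z, hz, hzP, -⟩ := BConn.meets h hC hx hxA hy hyB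
      exact hCP z hz hzP
    obtain ⟨C, hC, hCP⟩ := hLB P (Or.inl hP)
    obtain ⟨D, hD, hDP⟩ := hRB P (Or.inl hP)
    rcases side C (hL C hC).1 hCP with c1 | c1 <;> rcases side D (hR D hD).1 hDP with c2 | c2
    · rw [Set.union_comm] at *
      exact split_half hg.symm hL hR hLB hRB ihB C D hC hD c1 c2
    · exact ⟨C, hC, D, hD, B, A, Q, P, hg.symm, Set.union_comm _ _, c1, c2⟩
    · exact ⟨C, hC, D, hD, A, B, P, Q, hg, rfl, c1, c2⟩
    · exact split_half hg hL hR hLB hRB ihA C D hC hD c1 c2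

/-- The image of a bag under a partial map. -/
noncomputable def pim {V V' : Type*} (f : V' → Option V) (E : Finset V') : Finset V :=
  E.biUnion (fun x => (f x).toFinset)

lemma mem_pim {V V' : Type*} {f : V' → Option V} {E : Finset V'} {v : V} :
    v ∈ pim f E ↔ ∃ x ∈ E, f x = some v := by
  simp [pim]

lemma card_pim_le {V V' : Type*} (f : V' → Option V) (E : Finset V') :
    (pim f E).card ≤ E.card := by
  unfold pim
  refine Finset.card_biUnion_le.trans ?_
  refine (Finset.sum_le_card_nsmul E _ 1 ?_).trans (by simp)
  intro x _
  cases f x <;> simp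

lemma un_pim {V V' : Type*} {f : V' → Option V} {B : Set (Finset V')} {v : V} :
    Un (pim f '' B) v ↔ ∃ x, Un B x ∧ f x = some v := by
  constructor
  · rintro ⟨_, ⟨E, hE, rfl⟩, hv⟩
    obtain ⟨x, hx, h⟩ := mem_pim.mp hv
    exact ⟨x, ⟨E, hE, hx⟩, h⟩
  · rintro ⟨x, ⟨E, hE, hx⟩, h⟩
    exact ⟨_, ⟨E, hE, rfl⟩, mem_pim.mpr ⟨x, hx, h⟩⟩

lemma dec_pim {V V' : Type*} {w : ℕ} {B : Set (Finset V')} (hB : Dec w B) (f : V' → Option V) :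
    (∀ v, BConn B {x | f x = some v}) → Dec w (pim f '' B) := by
  induction hB with
  | single B h =>
    intro _
    rw [Set.image_singleton]
    exact Dec.single _ ((card_pim_le f B).trans h)
  | glue A B P Q hA hB hP hQ h hc ihA ihB =>
    intro hconn
    rw [Set.image_union]
    have key : ∀ v, Un (pim f '' A) v → Un (pim f '' B) v → ∃ z, f z = some v ∧ z ∈ P ∧ z ∈ Q := by
      intro v h1 h2
      obtain ⟨x, hx, hxv⟩ := un_pim.mp h1
      obtain ⟨y, hy, hyv⟩ := un_pim.mp h2
      exact BConn.meets h (hconn v) (x := x) (y := y) hxv hx hyv hy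
    refine Dec.glue _ _ (pim f P) (pim f Q) (ihA ?_) (ihB ?_) ⟨P, hP, rfl⟩ ⟨Q, hQ, rfl⟩ ?_ ?_
    · exact fun v => BConn.left hP h (hconn v)
    · intro v
      refine BConn.left (B := A) (Q := P) hQ (fun v h1 h2 => (h v h2 h1).symm) ?_
      rw [Set.union_comm]; exact hconn v
    · intro v h1 h2
      obtain ⟨z, hz, hzP, hzQ⟩ := key v h1 h2
      exact ⟨mem_pim.mpr ⟨z, hzP, hz⟩, mem_pim.mpr ⟨z, hzQ, hz⟩⟩
    · refine (Finset.card_le_card ?_).trans ((card_pim_le f (P ∩ Q)).trans hc)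
      intro v hv
      obtain ⟨h1, h2⟩ := Finset.mem_inter.mp hv
      obtain ⟨z, hz, hzP, hzQ⟩ := key v ⟨_, ⟨P, hP, rfl⟩, h1⟩ ⟨_, ⟨Q, hQ, rfl⟩, h2⟩
      exact mem_pim.mpr ⟨z, Finset.mem_inter.mpr ⟨hzP, hzQ⟩, hz⟩

lemma card_insert2_le {V : Type*} (x y : V) (Z : Finset V) :
    (insert x (insert y Z)).card ≤ Z.card + 2 := by
  have := Finset.card_insert_le x (insert y Z)
  have := Finset.card_insert_le y Z
  omega

/-- Extending a ladder by one rung. -/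
lemma ext_rung {V : Type*} {w : ℕ} {D : Set (Finset V)} (hD : Dec w D) {E Z : Finset V}
    (hE : E ∈ D) (hZ : Z ⊆ E) {x y x' y' : V} (hx : x ∈ E) (hy : y ∈ E) (hc : Z.card + 2 ≤ w)
    (hx' : ¬ Un D x') (hy' : ¬ Un D y') (hne : x' ≠ y') :
    ∃ D', Dec w D' ∧ D ⊆ D' ∧ (∃ E' ∈ D', Z ⊆ E' ∧ x' ∈ E' ∧ y' ∈ E') ∧ Share D' x x' ∧
      Share D' y y' ∧ ∀ v, Un D' v → Un D v ∨ v = x' ∨ v = y' := by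
  set E1 : Finset V := insert x' (insert x (insert y Z)) with hE1
  set E2 : Finset V := insert y' (insert x' (insert y Z)) with hE2
  have unE : ∀ v ∈ E, Un D v := fun v hv => ⟨E, hE, hv⟩
  have hyy : ∀ v ∈ E, v ≠ y' := fun v hv h => hy' (h ▸ unE v hv)
  have hxx : ∀ v ∈ E, v ≠ x' := fun v hv h => hx' (h ▸ unE v hv)
  have hE1' : ∀ v, v ∈ E1 ↔ v = x' ∨ v = x ∨ v = y ∨ v ∈ Z := by intro v; simp [hE1]
  have hE2' : ∀ v, v ∈ E2 ↔ v = y' ∨ v = x' ∨ v = y ∨ v ∈ Z := by intro v; simp [hE2]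
  have c1 : E1.card ≤ w + 1 := by
    rw [hE1]
    have := Finset.card_insert_le x' (insert x (insert y Z))
    have := card_insert2_le x y Z
    omega
  have c2 : E2.card ≤ w + 1 := by
    rw [hE2]
    have := Finset.card_insert_le y' (insert x' (insert y Z))
    have := card_insert2_le x' y Z
    omega
  have d1 : Dec w (D ∪ {E1}) := by
    refine Dec.glue D {E1} E E1 hD (Dec.single _ c1) hE rfl ?_ ?_
    · rintro v hv ⟨_, rfl, hv1⟩
      refine ⟨?_, hv1⟩
      rcases (hE1' v).mp hv1 with rfl | rfl | rfl | h
      · exact absurd hv hx'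
      · exact hx
      · exact hy
      · exact hZ h
    · refine (Finset.card_le_card (t := insert x (insert y Z)) ?_).trans
        ((card_insert2_le x y Z).trans hc)
      intro v hv
      obtain ⟨h1, h2⟩ := Finset.mem_inter.mp hv
      rcases (hE1' v).mp h2 with h | h | h | h
      · exact absurd h (hxx v h1)
      · simp [h]
      · simp [h]
      · simp [h]
  have d2 : Dec w ((D ∪ {E1}) ∪ {E2}) := by
    have hE1y : y' ∉ E1 := by
      intro h
      rcases (hE1' _).mp h with h | h | h | h
      · exact hne h.symm
      · exact hyy x hx h.symm
      · exact hyy y hy h.symm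
      · exact hyy _ (hZ h) rfl
    refine Dec.glue (D ∪ {E1}) {E2} E1 E2 d1 (Dec.single _ c2) (Or.inr rfl) rfl ?_ ?_
    · rintro v hv ⟨_, rfl, hv1⟩
      refine ⟨?_, hv1⟩
      rcases (hE2' v).mp hv1 with rfl | h | h | h
      · rcases un_union.mp hv with h | ⟨_, rfl, h⟩
        · exact absurd h hy'
        · exact h
      · exact (hE1' v).mpr (Or.inl h)
      · exact (hE1' v).mpr (Or.inr (Or.inr (Or.inl h)))
      · exact (hE1' v).mpr (Or.inr (Or.inr (Or.inr h)))
    · refine (Finset.card_le_card (t := insert x' (insert y Z)) ?_).trans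
        ((card_insert2_le x' y Z).trans hc)
      intro v hv
      obtain ⟨h1, h2⟩ := Finset.mem_inter.mp hv
      rcases (hE2' v).mp h2 with h | h | h | h
      · exact absurd (h ▸ h1) hE1y
      · simp [h]
      · simp [h]
      · simp [h]
  refine ⟨_, d2, fun e he => Or.inl (Or.inl he), ⟨E2, Or.inr rfl, ?_, ?_, ?_⟩, ?_, ?_, ?_⟩
  · exact fun v hv => (hE2' v).mpr (Or.inr (Or.inr (Or.inr hv)))
  · simp [hE2]
  · simp [hE2]
  · exact ⟨E1, Or.inl (Or.inr rfl), by simp [hE1], by simp [hE1]⟩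
  · exact ⟨E2, Or.inr rfl, by simp [hE2], by simp [hE2]⟩
  · intro v hv
    rcases un_union.mp hv with hv | ⟨_, rfl, hv⟩
    · rcases un_union.mp hv with hv | ⟨_, rfl, hv⟩
      · exact Or.inl hv
      · rcases (hE1' v).mp hv with h | h | h | h
        · exact Or.inr (Or.inl h)
        · exact Or.inl (unE v (h ▸ hx))
        · exact Or.inl (unE v (h ▸ hy))
        · exact Or.inl (unE v (hZ h))
    · rcases (hE2' v).mp hv with h | h | h | h
      · exact Or.inr (Or.inr h)
      · exact Or.inr (Or.inl h)
      · exact Or.inl (unE v (h ▸ hy))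
      · exact Or.inl (unE v (hZ h))

/-- Attaching a new vertex to two vertices sharing a bag. -/
lemma add_cherry {V : Type*} {w : ℕ} {D : Set (Finset V)} (hD : Dec w D) (hw : 2 ≤ w)
    {x y z : V} (h : Share D x y) (hz : ¬ Un D z) :
    ∃ D', Dec w D' ∧ D ⊆ D' ∧ Share D' x z ∧ Share D' y z ∧ ∀ v, Un D' v → Un D v ∨ v = z := by
  obtain ⟨E, hE, hx, hy⟩ := h
  have hzE : z ∉ E := fun h => hz ⟨E, hE, h⟩
  refine ⟨D ∪ {insert z {x, y}}, ?_, fun e he => Or.inl he, ⟨_, Or.inr rfl, by simp, by simp⟩,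
    ⟨_, Or.inr rfl, by simp, by simp⟩, ?_⟩
  · refine Dec.glue D _ E (insert z {x, y}) hD (Dec.single _ ?_) hE rfl ?_ ?_
    · have := card_insert2_le z x {y}
      simp at this
      omega
    · rintro v hv ⟨_, rfl, hv1⟩
      refine ⟨?_, hv1⟩
      simp only [Finset.mem_insert, Finset.mem_singleton] at hv1
      rcases hv1 with rfl | rfl | rfl
      · exact absurd hv hz
      · exact hx
      · exact hy
    · refine (Finset.card_le_card (t := {x, y}) ?_).trans ((Finset.card_le_two).trans hw)
      intro v hv
      obtain ⟨h1, h2⟩ := Finset.mem_inter.mp hv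
      rcases Finset.mem_insert.mp h2 with rfl | h
      · exact absurd h1 hzE
      · exact h
  · rintro v hv
    rcases un_union.mp hv with hv | ⟨_, rfl, hv⟩
    · exact Or.inl hv
    · simp only [Finset.mem_insert, Finset.mem_singleton] at hv
      rcases hv with h | rfl | rfl
      · exact Or.inr h
      · exact Or.inl ⟨E, hE, hx⟩
      · exact Or.inl ⟨E, hE, hy⟩

end SplitSection

/-! ### Part 3: graphs with a long ladder -/

section LadderSection

open Classical

/-- `G` contains a long ladder with rows `a`, `b` and subdivided rungs `c`, and `G'` is obtained
from `G` by clipping the columns `m` with `L ≤ m < r`. -/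
structure Ladder {V V' : Type*} (G : SimpleGraph V) (G' : SimpleGraph V') (F : V' → V)
    (a b c : ℕ → V) (t L r : ℕ) : Prop where
  hL : 0 < L
  hLr : L ≤ r
  hr : r < t
  inj : Function.Injective F
  range : ∀ v, (∃ x, F x = v) ↔ ∀ m, L ≤ m → m < r → v ≠ a m ∧ v ≠ b m ∧ v ≠ c m
  adj : ∀ x y, G.Adj (F x) (F y) → G'.Adj x y
  joina : ∀ x y, F x = a (L - 1) → F y = a r → G'.Adj x y
  joinb : ∀ x y, F x = b (L - 1) → F y = b r → G'.Adj x y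
  adj' : ∀ x y, G'.Adj x y → G.Adj (F x) (F y) ∨ (F x = a (L - 1) ∧ F y = a r) ∨
    (F y = a (L - 1) ∧ F x = a r) ∨ (F x = b (L - 1) ∧ F y = b r) ∨ (F y = b (L - 1) ∧ F x = b r)
  inja : ∀ m n, m < t → n < t → a m = a n → m = n
  injb : ∀ m n, m < t → n < t → b m = b n → m = n
  injc : ∀ m n, m < t → n < t → c m = c n → m = n
  hab : ∀ m n, m < t → n < t → a m ≠ b n
  hac : ∀ m n, m < t → n < t → a m ≠ c n
  hbc : ∀ m n, m < t → n < t → b m ≠ c n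
  adja : ∀ m, m + 1 < t → G.Adj (a m) (a (m + 1))
  adjb : ∀ m, m + 1 < t → G.Adj (b m) (b (m + 1))
  adjac : ∀ m, m < t → G.Adj (a m) (c m)
  adjbc : ∀ m, m < t → G.Adj (b m) (c m)
  nba : ∀ m, m + 2 < t → ∀ v, G.Adj (a (m + 1)) v → v = a m ∨ v = a (m + 2) ∨ v = c (m + 1)
  nbb : ∀ m, m + 2 < t → ∀ v, G.Adj (b (m + 1)) v → v = b m ∨ v = b (m + 2) ∨ v = c (m + 1)
  nbc : ∀ m, m < t → ∀ v, G.Adj (c m) v → v = a m ∨ v = b m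

/-- Being one of the vertices of the columns `i, ..., j`. -/
def InRow {V : Type*} (f : ℕ → V) (i j : ℕ) (v : V) : Prop := ∃ m, i ≤ m ∧ m ≤ j ∧ v = f m

lemma row_conn {V : Type*} {B : Set (Finset V)} (f : ℕ → V) (i j : ℕ)
    (h : ∀ m, i ≤ m → m < j → Share B (f m) (f (m + 1))) : BConn B {v | InRow f i j v} := by
  by_cases hij : i ≤ j
  · induction j, hij using Nat.le_induction with
    | base =>
      apply BConn.of_subsingleton
      rintro x ⟨m, h1, h2, rfl⟩ y ⟨n, h3, h4, rfl⟩
      congr 1; omega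
    | succ j hij ih =>
      have h1 := ih (fun m h1 h2 => h m h1 (by omega))
      have h2 := h1.insert (x := f j) (y := f (j + 1)) ⟨j, hij, le_rfl, rfl⟩ (h j hij (by omega))
      convert h2 using 1
      ext v
      constructor
      · rintro ⟨m, h3, h4, rfl⟩
        by_cases hm : m = j + 1
        · subst hm; exact Or.inl rfl
        · exact Or.inr ⟨m, h3, by omega, rfl⟩
      · rintro (rfl | ⟨m, h3, h4, rfl⟩)
        · exact ⟨j + 1, by omega, le_rfl, rfl⟩
        · exact ⟨m, h3, by omega, rfl⟩
  · apply BConn.of_subsingleton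
    rintro x ⟨m, h1, h2, rfl⟩
    omega

/-- Row connectivity in the clipped graph. -/
lemma row_conn' {V V' : Type*} {B : Set (Finset V')} {F : V' → V} (hF : Function.Injective F)
    (f : ℕ → V) (L r i j : ℕ) (hi : i < L) (hLr : L ≤ r) (hij : i ≤ j)
    (hk : ∀ m, i ≤ m → m ≤ j → ((m < L ∨ r ≤ m) ↔ ∃ x, F x = f m))
    (h : ∀ m x y, i ≤ m → m < j → F x = f m → F y = f (m + 1) → Share B x y)
    (hj : ∀ x y, F x = f (L - 1) → F y = f r → Share B x y) :
    BConn B {x | InRow f i j (F x)} := by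
  induction j, hij using Nat.le_induction with
  | base =>
    apply BConn.of_subsingleton
    rintro x ⟨m, h1, h2, hx⟩ y ⟨n, h3, h4, hy⟩
    apply hF
    rw [hx, hy]
    congr 1; omega
  | succ j hij ih =>
    have h1 := ih (fun m h1 h2 => hk m h1 (by omega)) (fun m x y h1 h2 => h m x y h1 (by omega))
    by_cases hkj : ∃ x, F x = f (j + 1)
    · obtain ⟨y, hy⟩ := hkj
      have : ∃ x, InRow f i j (F x) ∧ Share B x y := by
        rcases (hk (j + 1) (by omega) le_rfl).mpr ⟨y, hy⟩ with h3 | h3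
        · obtain ⟨x, hx⟩ := (hk j hij (by omega)).mp (Or.inl (by omega))
          exact ⟨x, ⟨j, hij, le_rfl, hx⟩, h j x y hij (by omega) hx hy⟩
        · by_cases hjr : j + 1 = r
          · obtain ⟨x, hx⟩ := (hk (L - 1) (by omega) (by omega)).mp (Or.inl (by omega))
            exact ⟨x, ⟨L - 1, by omega, by omega, hx⟩, hj x y hx (hjr ▸ hy)⟩
          · obtain ⟨x, hx⟩ := (hk j hij (by omega)).mp (Or.inr (by omega))
            exact ⟨x, ⟨j, hij, le_rfl, hx⟩, h j x y hij (by omega) hx hy⟩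
      obtain ⟨x, hx, hxy⟩ := this
      have h2 := h1.insert hx hxy
      convert h2 using 1
      ext v
      constructor
      · rintro ⟨m, h3, h4, hv⟩
        by_cases hm : m = j + 1
        · subst hm; exact Or.inl (hF (hv.trans hy.symm))
        · exact Or.inr ⟨m, h3, by omega, hv⟩
      · rintro (rfl | ⟨m, h3, h4, hv⟩)
        · exact ⟨j + 1, by omega, le_rfl, hy⟩
        · exact ⟨m, h3, by omega, hv⟩
    · convert h1 using 1
      ext v
      constructor
      · rintro ⟨m, h3, h4, hv⟩
        by_cases hm : m = j + 1
        · subst hm; exact absurd ⟨v, hv⟩ hkj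
        · exact ⟨m, h3, by omega, hv⟩
      · rintro ⟨m, h3, h4, hv⟩
        exact ⟨m, h3, by omega, hv⟩

lemma Covers.share {V : Type*} {G : SimpleGraph V} {B : Set (Finset V)} (h : Covers G B) {u v : V}
    (huv : G.Adj u v) : Share B u v := h.2 u v huv

/-- Clipping does not increase the width. -/
lemma Ladder.clip_le {V V' : Type*} {G : SimpleGraph V} {G' : SimpleGraph V'} {F : V' → V}
    {a b c : ℕ → V} {t L r : ℕ} (H : Ladder G G' F a b c t L r) (w : ℕ)
    (h : HasTreeDecompWidthLE G w) : HasTreeDecompWidthLE G' w := by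
  rw [hasTD_iff] at h ⊢
  obtain ⟨B, hB, hcov⟩ := h
  have hL := H.hL
  have hLr := H.hLr
  have hr := H.hr
  obtain ⟨xa, hxa⟩ := (H.range (a (L - 1))).mpr (fun m h1 h2 =>
    ⟨fun h => by have := H.inja _ _ (by omega) (by omega) h; omega,
      H.hab _ _ (by omega) (by omega), H.hac _ _ (by omega) (by omega)⟩)
  obtain ⟨xb, hxb⟩ := (H.range (b (L - 1))).mpr (fun m h1 h2 =>
    ⟨(H.hab _ _ (by omega) (by omega)).symm,
      fun h => by have := H.injb _ _ (by omega) (by omega) h; omega,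
      H.hbc _ _ (by omega) (by omega)⟩)
  let f : V → Option V' := fun v =>
    if InRow a (L - 1) (r - 1) v then some xa else if InRow b (L - 1) (r - 1) v then some xb
    else if h : ∃ x, F x = v then some h.choose else none
  have fa : ∀ v, InRow a (L - 1) (r - 1) v → f v = some xa := fun v hv => by simp [f, hv]
  have fb : ∀ v, InRow b (L - 1) (r - 1) v → f v = some xb := by
    intro v hv
    have : ¬ InRow a (L - 1) (r - 1) v := by
      rintro ⟨m, h1, h2, rfl⟩
      obtain ⟨n, h3, h4, h5⟩ := hv
      exact H.hab _ _ (by omega) (by omega) h5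
    simp [f, hv, this]
  have fF : ∀ x, f (F x) = some x := by
    intro x
    by_cases h1 : InRow a (L - 1) (r - 1) (F x)
    · rw [fa _ h1]
      obtain ⟨m, h2, h3, h4⟩ := h1
      by_cases hm : m = L - 1
      · rw [H.inj (h4.trans (hm ▸ hxa.symm))]
      · exact absurd h4 ((H.range (F x)).mp ⟨x, rfl⟩ m (by omega) (by omega)).1
    by_cases h1' : InRow b (L - 1) (r - 1) (F x)
    · rw [fb _ h1']
      obtain ⟨m, h2, h3, h4⟩ := h1'
      by_cases hm : m = L - 1
      · rw [H.inj (h4.trans (hm ▸ hxb.symm))]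
      · exact absurd h4 ((H.range (F x)).mp ⟨x, rfl⟩ m (by omega) (by omega)).2.1
    · have h2 : ∃ y, F y = F x := ⟨x, rfl⟩
      simp only [f, h1, h1', if_false, h2, dif_pos]
      congr 1
      exact H.inj h2.choose_spec
  have finv : ∀ v x, f v = some x → (x = xa ∧ InRow a (L - 1) (r - 1) v) ∨
      (x = xb ∧ InRow b (L - 1) (r - 1) v) ∨ v = F x := by
    intro v x hv
    by_cases h1 : InRow a (L - 1) (r - 1) v
    · rw [fa v h1] at hv
      exact Or.inl ⟨(Option.some.inj hv).symm, h1⟩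
    by_cases h1' : InRow b (L - 1) (r - 1) v
    · rw [fb v h1'] at hv
      exact Or.inr (Or.inl ⟨(Option.some.inj hv).symm, h1'⟩)
    · by_cases h2 : ∃ x, F x = v
      · obtain ⟨y, rfl⟩ := h2
        rw [fF] at hv
        exact Or.inr (Or.inr (by rw [Option.some.inj hv]))
      · simp [f, h1, h1', h2] at hv
  have hxab : xa ≠ xb := by
    rintro rfl
    exact H.hab _ _ (by omega) (by omega) (hxa.symm.trans hxb)
  refine ⟨pim f '' B, dec_pim hB f ?_, ?_, ?_⟩
  · intro x
    by_cases hx : x = xa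
    · subst hx
      convert row_conn (B := B) a (L - 1) (r - 1)
        (fun m h1 h2 => hcov.share (H.adja m (by omega))) using 1
      ext v
      constructor
      · intro hv
        rcases finv v x hv with ⟨_, h⟩ | ⟨h, _⟩ | h
        · exact h
        · exact absurd h hxab
        · exact ⟨L - 1, by omega, by omega, h.trans hxa⟩
      · exact fa v
    by_cases hx' : x = xb
    · subst hx'
      convert row_conn (B := B) b (L - 1) (r - 1)
        (fun m h1 h2 => hcov.share (H.adjb m (by omega))) using 1
      ext v
      constructor
      · intro hv
        rcases finv v x hv with ⟨h, _⟩ | ⟨_, h⟩ | h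
        · exact absurd h hx
        · exact h
        · exact ⟨L - 1, by omega, by omega, h.trans hxb⟩
      · exact fb v
    · apply BConn.of_subsingleton
      intro u hu v hv
      rcases finv u x hu with ⟨h, _⟩ | ⟨h, _⟩ | h
      · exact absurd h hx
      · exact absurd h hx'
      rcases finv v x hv with ⟨h', _⟩ | ⟨h', _⟩ | h'
      · exact absurd h' hx
      · exact absurd h' hx'
      exact h.trans h'.symm
  · intro x
    obtain ⟨E, hE, h⟩ := hcov.1 (F x)
    exact ⟨_, ⟨E, hE, rfl⟩, mem_pim.mpr ⟨F x, h, fF x⟩⟩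
  · have key : ∀ u v x y, G.Adj u v → f u = some x → f v = some y →
        Share (pim f '' B) x y := by
      intro u v x y huv hu hv
      obtain ⟨E, hE, h1, h2⟩ := hcov.share huv
      exact ⟨_, ⟨E, hE, rfl⟩, mem_pim.mpr ⟨u, h1, hu⟩, mem_pim.mpr ⟨v, h2, hv⟩⟩
    have keya : ∀ x y, F x = a (L - 1) → F y = a r → Share (pim f '' B) x y := by
      intro x y hx hy
      have hadj := H.adja (r - 1) (by omega)
      rw [show r - 1 + 1 = r by omega, ← hy] at hadj
      refine key _ _ x y hadj ?_ (fF y)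
      rw [fa _ ⟨r - 1, by omega, by omega, rfl⟩, H.inj (hx.trans hxa.symm)]
    have keyb : ∀ x y, F x = b (L - 1) → F y = b r → Share (pim f '' B) x y := by
      intro x y hx hy
      have hadj := H.adjb (r - 1) (by omega)
      rw [show r - 1 + 1 = r by omega, ← hy] at hadj
      refine key _ _ x y hadj ?_ (fF y)
      rw [fb _ ⟨r - 1, by omega, by omega, rfl⟩, H.inj (hx.trans hxb.symm)]
    intro x y hxy
    rcases H.adj' x y hxy with h | h | h | h | h
    · exact key _ _ x y h (fF x) (fF y)
    · exact keya x y h.1 h.2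
    · exact (keya y x h.1 h.2).symm
    · exact keyb x y h.1 h.2
    · exact (keyb y x h.1 h.2).symm

end LadderSection

/-! ### Part 4: extending a decomposition of the clipped graph -/

section ExtendSection

open Classical

lemma Dec.card_le {V : Type*} {w : ℕ} {B : Set (Finset V)} (hB : Dec w B) :
    ∀ E ∈ B, E.card ≤ w + 1 := by
  induction hB with
  | single B h => rintro E rfl; exact h
  | glue A B P Q hA hB hP hQ h hc ihA ihB =>
    rintro E (hE | hE)
    · exact ihA E hE
    · exact ihB E hE

lemma ext_ladder {V : Type*} {w : ℕ} {E1 : Set (Finset V)} (hE1 : Dec w E1) (a b : ℕ → V)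
    (t i : ℕ) (inja : ∀ m n, m < t → n < t → a m = a n → m = n)
    (injb : ∀ m n, m < t → n < t → b m = b n → m = n)
    (hab : ∀ m n, m < t → n < t → a m ≠ b n) {Z P : Finset V} (hP : P ∈ E1) (hZ : Z ⊆ P)
    (ha : a i ∈ P) (hb : b i ∈ P) (hc : Z.card + 2 ≤ w) (j : ℕ) (hij : i ≤ j) :
    j < t → (∀ n, i < n → n ≤ j → ¬ Un E1 (a n) ∧ ¬ Un E1 (b n)) →
    ∃ D, Dec w D ∧ E1 ⊆ D ∧ (∃ E ∈ D, Z ⊆ E ∧ a j ∈ E ∧ b j ∈ E) ∧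
      (∀ v, Un D v → Un E1 v ∨ ∃ n, i < n ∧ n ≤ j ∧ (v = a n ∨ v = b n)) ∧
      (∀ n, i ≤ n → n < j → Share D (a n) (a (n + 1)) ∧ Share D (b n) (b (n + 1))) ∧
      (∀ n, i ≤ n → n ≤ j → Share D (a n) (b n)) := by
  induction j, hij using Nat.le_induction with
  | base =>
    intro _ _
    refine ⟨E1, hE1, subset_rfl, ⟨P, hP, hZ, ha, hb⟩, fun v hv => Or.inl hv, ?_, ?_⟩
    · intro n h1 h2; omega
    · intro n h1 h2
      obtain rfl : n = i := by omega
      exact ⟨P, hP, ha, hb⟩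
  | succ j hij ih =>
    intro hjt hf
    obtain ⟨D, hD, hsub, ⟨E, hE, hZE, haE, hbE⟩, hun, hsh, hab'⟩ :=
      ih (by omega) (fun n h1 h2 => hf n h1 (by omega))
    have fa : ¬ Un D (a (j + 1)) := by
      intro h
      rcases hun _ h with h | ⟨n, h1, h2, h | h⟩
      · exact (hf (j + 1) (by omega) le_rfl).1 h
      · have := inja _ _ (by omega) (by omega) h; omega
      · exact hab _ _ (by omega) (by omega) h
    have fb : ¬ Un D (b (j + 1)) := by
      intro h
      rcases hun _ h with h | ⟨n, h1, h2, h | h⟩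
      · exact (hf (j + 1) (by omega) le_rfl).2 h
      · exact hab _ _ (by omega) (by omega) h.symm
      · have := injb _ _ (by omega) (by omega) h; omega
    obtain ⟨D', hD', hsub', ⟨E', hE', hZE', haE', hbE'⟩, hs1, hs2, hun'⟩ :=
      ext_rung hD hE hZE haE hbE hc fa fb (hab _ _ hjt hjt)
    refine ⟨D', hD', hsub.trans hsub', ⟨E', hE', hZE', haE', hbE'⟩, ?_, ?_, ?_⟩
    · intro v hv
      rcases hun' v hv with h | h | h
      · rcases hun v h with h | ⟨n, h1, h2, h⟩
        · exact Or.inl h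
        · exact Or.inr ⟨n, h1, by omega, h⟩
      · exact Or.inr ⟨j + 1, by omega, le_rfl, Or.inl h⟩
      · exact Or.inr ⟨j + 1, by omega, le_rfl, Or.inr h⟩
    · intro n h1 h2
      by_cases hn : n = j
      · subst hn; exact ⟨hs1, hs2⟩
      · obtain ⟨h3, h4⟩ := hsh n h1 (by omega)
        exact ⟨h3.mono hsub', h4.mono hsub'⟩
    · intro n h1 h2
      by_cases hn : n = j + 1
      · subst hn; exact ⟨E', hE', haE', hbE'⟩
      · exact (hab' n h1 (by omega)).mono hsub'

lemma add_cherries {V : Type*} {w : ℕ} {D : Set (Finset V)} (hD : Dec w D) (hw : 2 ≤ w)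
    (a b c : ℕ → V) (t i : ℕ) (injc : ∀ m n, m < t → n < t → c m = c n → m = n) (j : ℕ) :
    j ≤ t → (∀ n, i < n → n < j → Share D (a n) (b n)) →
    (∀ n, i < n → n < j → ¬ Un D (c n)) →
    ∃ D', Dec w D' ∧ D ⊆ D' ∧ (∀ v, Un D' v → Un D v ∨ ∃ n, i < n ∧ n < j ∧ v = c n) ∧
      (∀ n, i < n → n < j → Share D' (a n) (c n) ∧ Share D' (b n) (c n)) := by
  induction j with
  | zero =>
    intro _ _ _
    exact ⟨D, hD, subset_rfl, fun v hv => Or.inl hv, fun n h1 h2 => by omega⟩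
  | succ j ih =>
    intro hjt hs hf
    obtain ⟨D', hD', hsub, hun, hsh⟩ := ih (by omega) (fun n h1 h2 => hs n h1 (by omega))
      (fun n h1 h2 => hf n h1 (by omega))
    by_cases hij : i < j
    · have fc : ¬ Un D' (c j) := by
        intro h
        rcases hun _ h with h | ⟨n, h1, h2, h⟩
        · exact hf j hij (by omega) h
        · have := injc _ _ (by omega) (by omega) h; omega
      obtain ⟨D2, hD2, hsub2, h1, h2, hun2⟩ :=
        add_cherry hD' hw ((hs j hij (by omega)).mono hsub) fc
      refine ⟨D2, hD2, hsub.trans hsub2, ?_, ?_⟩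
      · intro v hv
        rcases hun2 v hv with h | h
        · rcases hun v h with h | ⟨n, h3, h4, h⟩
          · exact Or.inl h
          · exact Or.inr ⟨n, h3, by omega, h⟩
        · exact Or.inr ⟨j, hij, by omega, h⟩
      · intro n h3 h4
        by_cases hn : n = j
        · subst hn; exact ⟨h1, h2⟩
        · obtain ⟨h5, h6⟩ := hsh n h3 (by omega)
          exact ⟨h5.mono hsub2, h6.mono hsub2⟩
    · refine ⟨D', hD', hsub, ?_, fun n h1 h2 => hsh n h1 (by omega)⟩
      intro v hv
      rcases hun v hv with h | ⟨n, h3, h4, h⟩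
      · exact Or.inl h
      · exact Or.inr ⟨n, h3, by omega, h⟩

/-- Outside the columns `i, ..., j`. -/
def Outside {V : Type*} (a b c : ℕ → V) (i j : ℕ) (v : V) : Prop :=
  ¬ InRow a i j v ∧ ¬ InRow b i j v ∧ ¬ InRow c i j v

/-- Contract the columns `i, ..., j` onto column `z`. -/
noncomputable def colMap {V V' : Type*} (F : V' → V) (a b c : ℕ → V) (i j z : ℕ) (x : V') :
    Option V :=
  if InRow a i j (F x) then some (a z) else if InRow b i j (F x) then some (b z)
  else if InRow c i j (F x) then (if F x = c z then some (F x) else none) else some (F x)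

lemma colMap_inv {V V' : Type*} {F : V' → V} {a b c : ℕ → V} {i j z : ℕ} {x : V'} {v : V}
    (h : colMap F a b c i j z x = some v) :
    (v = a z ∧ InRow a i j (F x)) ∨ (v = b z ∧ InRow b i j (F x)) ∨ (v = F x ∧ v = c z) ∨
      (v = F x ∧ Outside a b c i j v) := by
  unfold colMap at h
  split_ifs at h with h1 h2 h3 h4
  · exact Or.inl ⟨(Option.some.inj h).symm, h1⟩
  · exact Or.inr (Or.inl ⟨(Option.some.inj h).symm, h2⟩)
  · have := (Option.some.inj h).symm
    exact Or.inr (Or.inr (Or.inl ⟨this, this.trans h4⟩))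
  · have := (Option.some.inj h).symm
    exact Or.inr (Or.inr (Or.inr ⟨this, this ▸ ⟨h1, h2, h3⟩⟩))

lemma colMap_out {V V' : Type*} {F : V' → V} {a b c : ℕ → V} {i j z : ℕ} {x : V'}
    (h : Outside a b c i j (F x)) : colMap F a b c i j z x = some (F x) := by
  simp [colMap, h.1, h.2.1, h.2.2]

section WithLadder

variable {V V' : Type*} {G : SimpleGraph V} {G' : SimpleGraph V'} {F : V' → V}
    {a b c : ℕ → V} {t L r : ℕ}

lemma Ladder.kepta (H : Ladder G G' F a b c t L r) {m : ℕ} (hm : m < t) :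
    (m < L ∨ r ≤ m) ↔ ∃ x, F x = a m := by
  rw [H.range]
  have := H.hr
  constructor
  · intro h n h1 h2
    exact ⟨fun h => by have := H.inja _ _ (by omega) (by omega) h; omega,
      H.hab _ _ (by omega) (by omega), H.hac _ _ (by omega) (by omega)⟩
  · intro h
    by_contra hn
    exact (h m (by omega) (by omega)).1 rfl

lemma Ladder.keptb (H : Ladder G G' F a b c t L r) {m : ℕ} (hm : m < t) :
    (m < L ∨ r ≤ m) ↔ ∃ x, F x = b m := by
  rw [H.range]
  have := H.hr
  constructor
  · intro h n h1 h2
    exact ⟨(H.hab _ _ (by omega) (by omega)).symm,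
      fun h => by have := H.injb _ _ (by omega) (by omega) h; omega,
      H.hbc _ _ (by omega) (by omega)⟩
  · intro h
    by_contra hn
    exact (h m (by omega) (by omega)).2.1 rfl

lemma Ladder.keptc (H : Ladder G G' F a b c t L r) {m : ℕ} (hm : m < t) :
    (m < L ∨ r ≤ m) ↔ ∃ x, F x = c m := by
  rw [H.range]
  have := H.hr
  constructor
  · intro h n h1 h2
    exact ⟨(H.hac _ _ (by omega) (by omega)).symm, (H.hbc _ _ (by omega) (by omega)).symm,
      fun h => by have := H.injc _ _ (by omega) (by omega) h; omega⟩
  · intro h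
    by_contra hn
    exact (h m (by omega) (by omega)).2.2 rfl

lemma Ladder.colMap_a {i j z : ℕ} {x : V'}
    (h : InRow a i j (F x)) : colMap F a b c i j z x = some (a z) := by
  simp [colMap, h]

lemma Ladder.colMap_b (H : Ladder G G' F a b c t L r) {i j z : ℕ} (hj : j < t) {x : V'}
    (h : InRow b i j (F x)) : colMap F a b c i j z x = some (b z) := by
  have : ¬ InRow a i j (F x) := by
    rintro ⟨m, h1, h2, h3⟩
    obtain ⟨n, h4, h5, h6⟩ := h
    exact H.hab m n (by omega) (by omega) (h3.symm.trans h6)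
  simp [colMap, h, this]

lemma Ladder.colMap_c (H : Ladder G G' F a b c t L r) {i j z : ℕ} (hj : j < t)
    (hzj : z ≤ j) {x : V'}
    (h : F x = c z) : colMap F a b c i j z x = some (c z) := by
  have h1 : ¬ InRow a i j (F x) := by
    rintro ⟨m, h1, h2, h3⟩
    exact H.hac m z (by omega) (by omega) (h3.symm.trans h)
  have h2 : ¬ InRow b i j (F x) := by
    rintro ⟨m, h1, h2, h3⟩
    exact H.hbc m z (by omega) (by omega) (h3.symm.trans h)
  rw [h] at h1 h2
  simp [colMap, h1, h2, h]

/-- Vertices of column `z` or outside are fixed. -/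
lemma Ladder.colMap_fix (H : Ladder G G' F a b c t L r) {i j z : ℕ} (hj : j < t) (hz : i ≤ z)
    (hzj : z ≤ j) {x : V'}
    (h : (F x = a z ∨ F x = b z ∨ F x = c z) ∨ Outside a b c i j (F x)) :
    colMap F a b c i j z x = some (F x) := by
  rcases h with (h | h | h) | h
  · rw [Ladder.colMap_a ⟨z, hz, hzj, h⟩, h]
  · rw [H.colMap_b hj ⟨z, hz, hzj, h⟩, h]
  · rw [H.colMap_c hj hzj h, h]
  · exact colMap_out h

lemma Ladder.colMap_dec (H : Ladder G G' F a b c t L r) {i j z : ℕ} (hj : j < t) (hz : i ≤ z)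
    (hzj : z ≤ j) {w : ℕ} {A : Set (Finset V')} (hA : Dec w A)
    (ha : BConn A {x | InRow a i j (F x)}) (hb : BConn A {x | InRow b i j (F x)}) :
    Dec w (pim (colMap F a b c i j z) '' A) := by
  refine dec_pim hA _ ?_
  intro v
  by_cases hva : v = a z
  · subst hva
    convert ha using 1
    ext x
    refine ⟨fun h => ?_, fun h => Ladder.colMap_a h⟩
    rcases colMap_inv h with h | h | h | h
    · exact h.2
    · exact absurd h.1 (H.hab _ _ (by omega) (by omega))
    · exact absurd h.2 (H.hac _ _ (by omega) (by omega))
    · exact absurd ⟨z, hz, hzj, rfl⟩ h.2.1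
  by_cases hvb : v = b z
  · subst hvb
    convert hb using 1
    ext x
    refine ⟨fun h => ?_, fun h => H.colMap_b hj h⟩
    rcases colMap_inv h with h | h | h | h
    · exact absurd h.1 hva
    · exact h.2
    · exact absurd h.2 (H.hbc _ _ (by omega) (by omega))
    · exact absurd ⟨z, hz, hzj, rfl⟩ h.2.2.1
  · apply BConn.of_subsingleton
    have : ∀ x, colMap F a b c i j z x = some v → v = F x := by
      intro x h
      rcases colMap_inv h with h | h | h | h
      · exact absurd h.1 hva
      · exact absurd h.1 hvb
      · exact h.1
      · exact h.1
    intro x hx y hy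
    exact H.inj ((this x hx).symm.trans (this y hy))

/-- The construction of the decomposition of the unclipped graph from a split decomposition. -/
lemma Ladder.extend_split (H : Ladder G G' F a b c t L r) {w i j : ℕ} (hi : i < L) (hrj : r ≤ j)
    (hj : j < t) {A1 A2 : Set (Finset V')} {P Q : Finset V'} (hg : Glu w A1 A2 P Q)
    (hcov : Covers G' (A1 ∪ A2))
    (hI : ∀ x, (F x = a i ∨ F x = b i ∨ F x = c i) → ¬ Un A2 x)
    (hJ : ∀ x, (F x = a j ∨ F x = b j ∨ F x = c j) → ¬ Un A1 x) :
    ∃ B, Dec w B ∧ Covers G B := by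
  have hLr := H.hLr
  have hij : i < j := by omega
  have rowa : BConn (A1 ∪ A2) {x | InRow a i j (F x)} := by
    refine row_conn' H.inj a L r i j hi hLr hij.le (fun m h1 h2 => H.kepta (by omega)) ?_ ?_
    · intro m x y h1 h2 hx hy
      refine hcov.share (H.adj _ _ ?_)
      rw [hx, hy]
      exact H.adja m (by omega)
    · intro x y hx hy
      exact hcov.share (H.joina x y hx hy)
  have rowb : BConn (A1 ∪ A2) {x | InRow b i j (F x)} := by
    refine row_conn' H.inj b L r i j hi hLr hij.le (fun m h1 h2 => H.keptb (by omega)) ?_ ?_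
    · intro m x y h1 h2 hx hy
      refine hcov.share (H.adj _ _ ?_)
      rw [hx, hy]
      exact H.adjb m (by omega)
    · intro x y hx hy
      exact hcov.share (H.joinb x y hx hy)
  have side : ∀ x, Un A1 x ∨ Un A2 x := fun x => un_union.mp (hcov.1 x)
  -- vertices of the rows in the middle bag
  obtain ⟨α, hα, hαP, hαQ⟩ : ∃ z ∈ {x | InRow a i j (F x)}, z ∈ P ∧ z ∈ Q := by
    obtain ⟨x, hx⟩ := (H.kepta (m := i) (by omega)).mp (Or.inl hi)
    obtain ⟨y, hy⟩ := (H.kepta (m := j) (by omega)).mp (Or.inr hrj)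
    exact BConn.meets hg.inter rowa (x := x) (y := y) ⟨i, le_rfl, hij.le, hx⟩
      ((side x).resolve_right (hI x (Or.inl hx))) ⟨j, hij.le, le_rfl, hy⟩
      ((side y).resolve_left (hJ y (Or.inl hy)))
  obtain ⟨β, hβ, hβP, hβQ⟩ : ∃ z ∈ {x | InRow b i j (F x)}, z ∈ P ∧ z ∈ Q := by
    obtain ⟨x, hx⟩ := (H.keptb (m := i) (by omega)).mp (Or.inl hi)
    obtain ⟨y, hy⟩ := (H.keptb (m := j) (by omega)).mp (Or.inr hrj)
    exact BConn.meets hg.inter rowb (x := x) (y := y) ⟨i, le_rfl, hij.le, hx⟩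
      ((side x).resolve_right (hI x (Or.inr (Or.inl hx)))) ⟨j, hij.le, le_rfl, hy⟩
      ((side y).resolve_left (hJ y (Or.inr (Or.inl hy))))
  set E1 := pim (colMap F a b c i j i) '' A1 with hE1
  set E2 := pim (colMap F a b c i j j) '' A2 with hE2
  have dE1 : Dec w E1 := H.colMap_dec hj le_rfl hij.le hg.decA
    (BConn.left hg.hP hg.inter rowa) (BConn.left hg.hP hg.inter rowb)
  have dE2 : Dec w E2 := by
    refine H.colMap_dec hj hij.le le_rfl hg.decB
      (BConn.left (B := A1) hg.hQ hg.symm.inter ?_) (BConn.left (B := A1) hg.hQ hg.symm.inter ?_)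
    · rw [Set.union_comm]; exact rowa
    · rw [Set.union_comm]; exact rowb
  set Z : Finset V := ((P ∩ Q).image F).filter (Outside a b c i j) with hZ
  have memZ : ∀ v, v ∈ Z ↔ (∃ x, x ∈ P ∧ x ∈ Q ∧ F x = v) ∧ Outside a b c i j v := by
    intro v
    simp [hZ, and_assoc]
  have cZ : Z.card + 2 ≤ w := by
    have hαZ : F α ∉ Z := fun h => ((memZ _).mp h).2.1 hα
    have hβZ : F β ∉ Z := fun h => ((memZ _).mp h).2.2.1 hβ
    have hne : F α ≠ F β := by
      obtain ⟨m, h1, h2, h3⟩ := hα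
      obtain ⟨n, h4, h5, h6⟩ := hβ
      rw [h3, h6]
      exact H.hab _ _ (by omega) (by omega)
    have h1 : (insert (F α) (insert (F β) Z)).card = Z.card + 2 := by
      rw [Finset.card_insert_of_notMem, Finset.card_insert_of_notMem hβZ]
      simp [hne, hαZ]
    have h2 : insert (F α) (insert (F β) Z) ⊆ (P ∩ Q).image F := by
      intro v hv
      simp only [Finset.mem_insert] at hv
      rcases hv with rfl | rfl | hv
      · exact Finset.mem_image_of_mem _ (Finset.mem_inter.mpr ⟨hαP, hαQ⟩)
      · exact Finset.mem_image_of_mem _ (Finset.mem_inter.mpr ⟨hβP, hβQ⟩)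
      · exact (Finset.mem_filter.mp hv).1
    have h3 := Finset.card_le_card h2
    have h4 : ((P ∩ Q).image F).card ≤ (P ∩ Q).card := Finset.card_image_le
    have h5 := hg.card
    omega
  -- build the ladder
  have inE1 : ∀ v, Un E1 v → v = a i ∨ v = b i ∨ v = c i ∨ Outside a b c i j v := by
    intro v hv
    obtain ⟨x, hx, h⟩ := un_pim.mp hv
    rcases colMap_inv h with h | h | h | h
    · exact Or.inl h.1
    · exact Or.inr (Or.inl h.1)
    · exact Or.inr (Or.inr (Or.inl h.2))
    · exact Or.inr (Or.inr (Or.inr h.2))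
  have inE2 : ∀ v, Un E2 v → v = a j ∨ v = b j ∨ v = c j ∨ Outside a b c i j v := by
    intro v hv
    obtain ⟨x, hx, h⟩ := un_pim.mp hv
    rcases colMap_inv h with h | h | h | h
    · exact Or.inl h.1
    · exact Or.inr (Or.inl h.1)
    · exact Or.inr (Or.inr (Or.inl h.2))
    · exact Or.inr (Or.inr (Or.inr h.2))
  obtain ⟨D, hD, hsub, ⟨E, hE, hZE, haE, hbE⟩, hun, hsh, hab⟩ :=
    ext_ladder dE1 a b t i H.inja H.injb H.hab (Z := Z) (P := pim (colMap F a b c i j i) P)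
      ⟨P, hg.hP, rfl⟩
      (by
        intro v hv
        obtain ⟨⟨x, hxP, hxQ, rfl⟩, ho⟩ := (memZ v).mp hv
        exact mem_pim.mpr ⟨x, hxP, colMap_out ho⟩)
      (mem_pim.mpr ⟨α, hαP, Ladder.colMap_a hα⟩) (mem_pim.mpr ⟨β, hβP, H.colMap_b hj hβ⟩) cZ j
      hij.le hj
      (by
        intro n h1 h2
        constructor
        · intro h
          rcases inE1 _ h with h | h | h | h
          · have := H.inja _ _ (by omega) (by omega) h; omega
          · exact H.hab _ _ (by omega) (by omega) h
          · exact H.hac _ _ (by omega) (by omega) h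
          · exact h.1 ⟨n, h1.le, h2, rfl⟩
        · intro h
          rcases inE1 _ h with h | h | h | h
          · exact H.hab _ _ (by omega) (by omega) h.symm
          · have := H.injb _ _ (by omega) (by omega) h; omega
          · exact H.hbc _ _ (by omega) (by omega) h
          · exact h.2.1 ⟨n, h1.le, h2, rfl⟩)
  -- glue
  have interDE : ∀ v, Un D v → Un E2 v → v = a j ∨ v = b j ∨ v ∈ Z := by
    intro v hv hv2
    by_cases hva : v = a j
    · exact Or.inl hva
    by_cases hvb : v = b j
    · exact Or.inr (Or.inl hvb)
    obtain ⟨y, hy, hyv⟩ := un_pim.mp hv2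
    have hy2 : v = F y ∧ (v = c j ∨ Outside a b c i j v) := by
      rcases colMap_inv hyv with h | h | h | h
      · exact absurd h.1 hva
      · exact absurd h.1 hvb
      · exact ⟨h.1, Or.inl h.2⟩
      · exact ⟨h.1, Or.inr h.2⟩
    have notrow : ∀ n, i ≤ n → n ≤ j → v ≠ a n ∧ v ≠ b n := by
      intro n h1 h2
      rcases hy2.2 with h | h
      · rw [h]
        exact ⟨(H.hac _ _ (by omega) (by omega)).symm, (H.hbc _ _ (by omega) (by omega)).symm⟩
      · exact ⟨fun h3 => h.1 ⟨n, h1, h2, h3⟩, fun h3 => h.2.1 ⟨n, h1, h2, h3⟩⟩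
    rcases hun v hv with h | ⟨n, h1, h2, h | h⟩
    · obtain ⟨x, hx, hxv⟩ := un_pim.mp h
      have hvx : v = F x := by
        rcases colMap_inv hxv with h | h | h | h
        · exact absurd h.1 (notrow i le_rfl hij.le).1
        · exact absurd h.1 (notrow i le_rfl hij.le).2
        · exact h.1
        · exact h.1
      obtain rfl : x = y := H.inj (hvx.symm.trans hy2.1)
      obtain ⟨hxP, hxQ⟩ := hg.inter x hx hy
      rcases hy2.2 with h | h
      · exact absurd hx (hJ x (Or.inr (Or.inr (hvx.symm.trans h))))
      · exact Or.inr (Or.inr ((memZ v).mpr ⟨⟨x, hxP, hxQ, hvx.symm⟩, h⟩))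
    · exact absurd h (notrow n h1.le h2).1
    · exact absurd h (notrow n h1.le h2).2
  have hQ2 : pim (colMap F a b c i j j) Q ∈ E2 := ⟨Q, hg.hQ, rfl⟩
  have dU : Dec w (D ∪ E2) := by
    refine Dec.glue D E2 E (pim (colMap F a b c i j j) Q) hD dE2 hE hQ2 ?_ ?_
    · intro v h1 h2
      rcases interDE v h1 h2 with rfl | rfl | h
      · exact ⟨haE, mem_pim.mpr ⟨α, hαQ, Ladder.colMap_a hα⟩⟩
      · exact ⟨hbE, mem_pim.mpr ⟨β, hβQ, H.colMap_b hj hβ⟩⟩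
      · refine ⟨hZE h, ?_⟩
        obtain ⟨⟨x, hxP, hxQ, rfl⟩, ho⟩ := (memZ v).mp h
        exact mem_pim.mpr ⟨x, hxQ, colMap_out ho⟩
    · refine (Finset.card_le_card (t := insert (a j) (insert (b j) Z)) ?_).trans
        ((card_insert2_le _ _ Z).trans cZ)
      intro v hv
      obtain ⟨h1, h2⟩ := Finset.mem_inter.mp hv
      have := interDE v ⟨E, hE, h1⟩ ⟨_, hQ2, h2⟩
      simpa using this
  -- the rungs
  obtain ⟨D2, hD2, hsub2, -, hrung⟩ := add_cherries dU (by omega) a b c t i H.injc j hj.le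
    (fun n h1 h2 => (hab n h1.le h2.le).mono Set.subset_union_left)
    (by
      intro n h1 h2 h
      rcases un_union.mp h with h | h
      · rcases hun _ h with h | ⟨m, h3, h4, h | h⟩
        · rcases inE1 _ h with h | h | h | h
          · exact H.hac _ _ (by omega) (by omega) h.symm
          · exact H.hbc _ _ (by omega) (by omega) h.symm
          · have := H.injc _ _ (by omega) (by omega) h; omega
          · exact h.2.2 ⟨n, h1.le, h2.le, rfl⟩
        · exact H.hac _ _ (by omega) (by omega) h.symm
        · exact H.hbc _ _ (by omega) (by omega) h.symm
      · rcases inE2 _ h with h | h | h | h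
        · exact H.hac _ _ (by omega) (by omega) h.symm
        · exact H.hbc _ _ (by omega) (by omega) h.symm
        · have := H.injc _ _ (by omega) (by omega) h; omega
        · exact h.2.2 ⟨n, h1.le, h2.le, rfl⟩)
  have hsubD : D ⊆ D2 := Set.subset_union_left.trans hsub2
  have hsubE1 : E1 ⊆ D2 := hsub.trans hsubD
  have hsubE2 : E2 ⊆ D2 := Set.subset_union_right.trans hsub2
  -- vertices that are not strictly inside
  let Inner : V → Prop := fun v => ∃ n, i < n ∧ n < j ∧ (v = a n ∨ v = b n ∨ v = c n)
  have pre : ∀ v, ¬ Inner v → ∃ x, F x = v := by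
    intro v hv
    rw [H.range]
    intro m h1 h2
    refine ⟨fun h => hv ⟨m, by omega, by omega, Or.inl h⟩,
      fun h => hv ⟨m, by omega, by omega, Or.inr (Or.inl h)⟩,
      fun h => hv ⟨m, by omega, by omega, Or.inr (Or.inr h)⟩⟩
  have tri : ∀ v, ¬ Inner v → ((v = a i ∨ v = b i ∨ v = c i) ∨ (v = a j ∨ v = b j ∨ v = c j)) ∨
      Outside a b c i j v := by
    intro v hv
    by_contra hn
    push Not at hn
    obtain ⟨⟨h1, h2⟩, h3⟩ := hn
    refine h3 ⟨?_, ?_, ?_⟩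
    · rintro ⟨m, h4, h5, h6⟩
      have e1 : m ≠ i := fun e => h1.1 (e ▸ h6)
      have e2 : m ≠ j := fun e => h2.1 (e ▸ h6)
      exact hv ⟨m, by omega, by omega, Or.inl h6⟩
    · rintro ⟨m, h4, h5, h6⟩
      have e1 : m ≠ i := fun e => h1.2.1 (e ▸ h6)
      have e2 : m ≠ j := fun e => h2.2.1 (e ▸ h6)
      exact hv ⟨m, by omega, by omega, Or.inr (Or.inl h6)⟩
    · rintro ⟨m, h4, h5, h6⟩
      have e1 : m ≠ i := fun e => h1.2.2 (e ▸ h6)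
      have e2 : m ≠ j := fun e => h2.2.2 (e ▸ h6)
      exact hv ⟨m, by omega, by omega, Or.inr (Or.inr h6)⟩
  have fix1 : ∀ x, ¬ Inner (F x) → Un A1 x → colMap F a b c i j i x = some (F x) := by
    intro x hx hu
    refine H.colMap_fix hj le_rfl hij.le ?_
    rcases tri _ hx with (h | h) | h
    · exact Or.inl h
    · exact absurd hu (hJ x h)
    · exact Or.inr h
  have fix2 : ∀ x, ¬ Inner (F x) → Un A2 x → colMap F a b c i j j x = some (F x) := by
    intro x hx hu
    refine H.colMap_fix hj hij.le le_rfl ?_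
    rcases tri _ hx with (h | h) | h
    · exact absurd hu (hI x h)
    · exact Or.inl h
    · exact Or.inr h
  have bagkey : ∀ x y, ¬ Inner (F x) → ¬ Inner (F y) → Share (A1 ∪ A2) x y →
      Share D2 (F x) (F y) := by
    rintro x y hx hy ⟨e, he | he, h1, h2⟩
    · exact ⟨_, hsubE1 ⟨e, he, rfl⟩, mem_pim.mpr ⟨x, h1, fix1 x hx ⟨e, he, h1⟩⟩,
        mem_pim.mpr ⟨y, h2, fix1 y hy ⟨e, he, h2⟩⟩⟩
    · exact ⟨_, hsubE2 ⟨e, he, rfl⟩, mem_pim.mpr ⟨x, h1, fix2 x hx ⟨e, he, h1⟩⟩,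
        mem_pim.mpr ⟨y, h2, fix2 y hy ⟨e, he, h2⟩⟩⟩
  have inner : ∀ u v, Inner u → G.Adj u v → Share D2 u v := by
    rintro u v ⟨n, h1, h2, h⟩ huv
    obtain ⟨m, rfl⟩ : ∃ m, n = m + 1 := ⟨n - 1, by omega⟩
    rcases h with rfl | rfl | rfl
    · rcases H.nba m (by omega) v huv with rfl | rfl | rfl
      · exact ((hsh m (by omega) (by omega)).1.symm).mono hsubD
      · exact ((hsh (m + 1) (by omega) (by omega)).1).mono hsubD
      · exact (hrung (m + 1) h1 h2).1
    · rcases H.nbb m (by omega) v huv with rfl | rfl | rfl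
      · exact ((hsh m (by omega) (by omega)).2.symm).mono hsubD
      · exact ((hsh (m + 1) (by omega) (by omega)).2).mono hsubD
      · exact (hrung (m + 1) h1 h2).2
    · rcases H.nbc (m + 1) (by omega) v huv with rfl | rfl
      · exact (hrung (m + 1) h1 h2).1.symm
      · exact (hrung (m + 1) h1 h2).2.symm
  refine ⟨D2, hD2, ?_, ?_⟩
  · intro v
    by_cases hv : Inner v
    · obtain ⟨n, h1, h2, h⟩ := hv
      rcases h with rfl | rfl | rfl
      · exact (hrung n h1 h2).1.un
      · exact (hrung n h1 h2).2.un
      · exact (hrung n h1 h2).1.symm.un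
    · obtain ⟨x, rfl⟩ := pre v hv
      obtain ⟨e, he, hx⟩ := hcov.1 x
      exact (bagkey x x hv hv ⟨e, he, hx, hx⟩).un
  · intro u v huv
    by_cases hu : Inner u
    · exact inner u v hu huv
    by_cases hv : Inner v
    · exact (inner v u hv huv.symm).symm
    obtain ⟨x, rfl⟩ := pre u hu
    obtain ⟨y, rfl⟩ := pre v hv
    exact bagkey x y hu hv (hcov.share (H.adj x y huv))

/-- The column `m` in the clipped graph. -/
def colSet {V V' : Type*} (F : V' → V) (a b c : ℕ → V) (m : ℕ) : Set V' :=
  {x | F x = a m ∨ F x = b m ∨ F x = c m}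

lemma Ladder.col_conn (H : Ladder G G' F a b c t L r) {m : ℕ} (hm : m < t) (hk : m < L ∨ r ≤ m)
    {B : Set (Finset V')} (hcov : Covers G' B) :
    BConn B (colSet F a b c m) ∧ ∃ x ∈ colSet F a b c m, Un B x := by
  obtain ⟨x, hx⟩ := (H.kepta hm).mp hk
  obtain ⟨y, hy⟩ := (H.keptb hm).mp hk
  obtain ⟨z, hz⟩ := (H.keptc hm).mp hk
  refine ⟨?_, x, Or.inl hx, hcov.1 x⟩
  have h0 : BConn B {x} := BConn.of_subsingleton _ _ (by rintro u rfl v rfl; rfl)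
  have h1 := h0.insert (x := x) (y := z) rfl
    (hcov.share (H.adj _ _ (by rw [hx, hz]; exact H.adjac m hm)))
  have h2 := h1.insert (x := z) (y := y) (Or.inl rfl)
    (hcov.share (H.adj _ _ (by rw [hz, hy]; exact (H.adjbc m hm).symm)))
  convert h2 using 1
  ext u
  constructor
  · rintro (h | h | h)
    · exact Or.inr (Or.inr (H.inj (h.trans hx.symm)))
    · exact Or.inl (H.inj (h.trans hy.symm))
    · exact Or.inr (Or.inl (H.inj (h.trans hz.symm)))
  · rintro (h | h | h)
    · exact Or.inr (Or.inl (h ▸ hy))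
    · exact Or.inr (Or.inr (h ▸ hz))
    · have : u = x := h
      exact Or.inl (this ▸ hx)

lemma Ladder.col_disj (H : Ladder G G' F a b c t L r) {m n : ℕ} (hm : m < t) (hn : n < t)
    {x : V'} (h1 : x ∈ colSet F a b c m) (h2 : x ∈ colSet F a b c n) : m = n := by
  rcases h1 with h1 | h1 | h1 <;> rcases h2 with h2 | h2 | h2 <;> rw [h1] at h2
  · exact H.inja _ _ hm hn h2
  · exact absurd h2 (H.hab _ _ hm hn)
  · exact absurd h2 (H.hac _ _ hm hn)
  · exact absurd h2.symm (H.hab _ _ hn hm)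
  · exact H.injb _ _ hm hn h2
  · exact absurd h2 (H.hbc _ _ hm hn)
  · exact absurd h2.symm (H.hac _ _ hn hm)
  · exact absurd h2.symm (H.hbc _ _ hn hm)
  · exact H.injc _ _ hm hn h2

lemma Ladder.col_avoid (H : Ladder G G' F a b c t L r) {w s : ℕ} (hs : s + (w + 2) ≤ t)
    {E : Finset V'} (hE : E.card ≤ w + 1) :
    ∃ m, s ≤ m ∧ m < s + (w + 2) ∧ ∀ x ∈ colSet F a b c m, x ∉ E := by
  by_contra hn
  push Not at hn
  have : ∀ k : Fin (w + 2), ∃ x ∈ colSet F a b c (s + k), x ∈ E :=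
    fun k => hn (s + k) (by omega) (by omega)
  choose g hg hgE using this
  have hinj : Function.Injective g := by
    intro k l hkl
    have := H.col_disj (m := s + k) (n := s + l) (by omega) (by omega) (hg k) (hkl ▸ hg l)
    exact Fin.ext (by omega)
  have h1 : (Finset.univ.image g).card = w + 2 := by
    rw [Finset.card_image_of_injective _ hinj]; simp
  have h2 : Finset.univ.image g ⊆ E := by
    intro x hx
    obtain ⟨k, -, rfl⟩ := Finset.mem_image.mp hx
    exact hgE k
  have := Finset.card_le_card h2
  omega

/-- Unclipping a sufficiently long ladder does not increase the width. -/
lemma Ladder.extend (H : Ladder G G' F a b c t L r) (w : ℕ) (hL : w + 2 ≤ L)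
    (hr : r + (w + 2) ≤ t) (h : HasTreeDecompWidthLE G' w) : HasTreeDecompWidthLE G w := by
  rw [hasTD_iff] at h ⊢
  obtain ⟨B, hB, hcov⟩ := h
  have hLr := H.hLr
  obtain ⟨C, hC, D, hD, A1, A2, P, Q, hg, rfl, hCA, hDA⟩ := split_dec hB
    {C | ∃ m, m < L ∧ C = colSet F a b c m} {C | ∃ m, r ≤ m ∧ m < t ∧ C = colSet F a b c m}
    (by
      rintro _ ⟨m, hm, rfl⟩
      exact H.col_conn (by omega) (Or.inl hm) hcov)
    (by
      rintro _ ⟨m, hm, hm', rfl⟩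
      exact H.col_conn hm' (Or.inr hm) hcov)
    (by
      intro E hE
      obtain ⟨m, h1, h2, h3⟩ := H.col_avoid (s := 0) (w := w) (by omega) (hB.card_le E hE)
      exact ⟨_, ⟨m, by omega, rfl⟩, h3⟩)
    (by
      intro E hE
      obtain ⟨m, h1, h2, h3⟩ := H.col_avoid (s := r) (w := w) (by omega) (hB.card_le E hE)
      exact ⟨_, ⟨m, by omega, by omega, rfl⟩, h3⟩)
  obtain ⟨i, hi, rfl⟩ := hC
  obtain ⟨j, hrj, hj, rfl⟩ := hD
  exact H.extend_split hi hrj hj hg hcov hCA hDA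

end WithLadder

end ExtendSection

/-! ### Part 5: display graphs of phylogenetic trees -/

section PhyloSection

section Display

variable {V1 V2 X : Type*} {l1 : X → V1} {l2 : X → V2}

lemma td_surj (A : DisplayVertex l1 l2) : toDisplay l1 l2 A.1 = A := Subtype.ext A.2

lemma td_inl_inj {u v : V1} (h : toDisplay l1 l2 (Sum.inl u) = toDisplay l1 l2 (Sum.inl v)) :
    u = v := by
  have := congrArg Subtype.val h
  simpa [toDisplay, mergeMap] using this

lemma merge_leaf (h2 : Function.Injective l2) (x : X) :
    mergeMap l1 l2 (Sum.inr (l2 x)) = Sum.inl (l1 x) := by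
  have h : ∃ y, l2 y = l2 x := ⟨x, rfl⟩
  have h3 : mergeMap l1 l2 (Sum.inr (l2 x)) = Sum.inl (l1 h.choose) := by
    simp only [mergeMap, h, dif_pos]
  rw [h3, h2 h.choose_spec]

lemma merge_nonleaf {w : V2} (h : ∀ x, l2 x ≠ w) :
    mergeMap l1 l2 (Sum.inr w) = Sum.inr w := by
  have h : ¬ ∃ y, l2 y = w := fun ⟨y, hy⟩ => h y hy
  simp [mergeMap, h]

lemma td_leaf (h2 : Function.Injective l2) (x : X) :
    toDisplay l1 l2 (Sum.inr (l2 x)) = toDisplay l1 l2 (Sum.inl (l1 x)) :=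
  Subtype.ext (merge_leaf h2 x)

lemma td_inl_inr (h2 : Function.Injective l2) {u : V1} {w : V2}
    (h : toDisplay l1 l2 (Sum.inl u) = toDisplay l1 l2 (Sum.inr w)) :
    ∃ x, u = l1 x ∧ w = l2 x := by
  by_cases hw : ∃ x, l2 x = w
  · obtain ⟨x, rfl⟩ := hw
    rw [td_leaf h2] at h
    exact ⟨x, td_inl_inj h, rfl⟩
  · have h3 := congrArg Subtype.val h
    push Not at hw
    simp only [toDisplay, merge_nonleaf hw] at h3
    simp [mergeMap] at h3

lemma td_inr_inj (h1 : Function.Injective l1) (h2 : Function.Injective l2) {u v : V2}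
    (h : toDisplay l1 l2 (Sum.inr u) = toDisplay l1 l2 (Sum.inr v)) : u = v := by
  by_cases hw : ∃ x, l2 x = u
  · obtain ⟨x, rfl⟩ := hw
    rw [td_leaf h2] at h
    obtain ⟨y, h3, h4⟩ := td_inl_inr h2 h
    rw [h4, h1 h3]
  · by_cases hv : ∃ x, l2 x = v
    · obtain ⟨x, rfl⟩ := hv
      rw [td_leaf h2] at h
      obtain ⟨y, h3, h4⟩ := td_inl_inr h2 h.symm
      rw [h4, h1 h3]
    · have h3 := congrArg Subtype.val h
      push Not at hw hv
      simpa [toDisplay, merge_nonleaf hw, merge_nonleaf hv] using h3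

lemma display_adj (h1 : Function.Injective l1) (h2 : Function.Injective l2)
    (G1 : SimpleGraph V1) (G2 : SimpleGraph V2) (A B : DisplayVertex l1 l2) :
    (displayGraph G1 l1 G2 l2).Adj A B ↔
      (∃ u v, G1.Adj u v ∧ A = toDisplay l1 l2 (Sum.inl u) ∧ B = toDisplay l1 l2 (Sum.inl v)) ∨
      (∃ u v, G2.Adj u v ∧ A = toDisplay l1 l2 (Sum.inr u) ∧ B = toDisplay l1 l2 (Sum.inr v)) := by
  unfold displayGraph
  rw [SimpleGraph.fromRel_adj]
  constructor
  · rintro ⟨-, h | h⟩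
    · exact h
    · rcases h with ⟨u, v, h, h3, h4⟩ | ⟨u, v, h, h3, h4⟩
      · exact Or.inl ⟨v, u, h.symm, h4, h3⟩
      · exact Or.inr ⟨v, u, h.symm, h4, h3⟩
  · intro h
    refine ⟨?_, Or.inl h⟩
    rcases h with ⟨u, v, h, rfl, rfl⟩ | ⟨u, v, h, rfl, rfl⟩
    · exact fun h3 => h.ne (td_inl_inj h3)
    · exact fun h3 => h.ne (td_inr_inj h1 h2 h3)

end Display

/-- The data of one tree, its chain and its clipped version. -/
structure Half {V W X Y : Type*} (G : SimpleGraph V) (l : X → V) (G' : SimpleGraph W) (l' : Y → W)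
    (ι : Y → X) (φ : W → V) (C : ℕ → X) (P : ℕ → V) (t L r : ℕ) : Prop where
  linj : Function.Injective l
  linj' : Function.Injective l'
  finj : Function.Injective φ
  fl : ∀ y, φ (l' y) = l (ι y)
  range : ∀ v, (∃ w, φ w = v) ↔ ∀ m, L ≤ m → m < r → l (C m) ≠ v ∧ P m ≠ v
  adj : ∀ a b, G'.Adj a b ↔ (G.Adj (φ a) (φ b) ∨ (φ a = P (L - 1) ∧ φ b = P r) ∨
    (φ b = P (L - 1) ∧ φ a = P r))
  Pinj : ∀ m n, m < t → n < t → P m = P n → m = n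
  Pnl : ∀ m, m < t → ∀ x, l x ≠ P m
  adjP : ∀ m, m + 1 < t → G.Adj (P m) (P (m + 1))
  adjC : ∀ m, m < t → G.Adj (P m) (l (C m))
  nbP : ∀ m, m + 2 < t → ∀ v, G.Adj (P (m + 1)) v → v = P m ∨ v = P (m + 2) ∨ v = l (C (m + 1))
  nbC : ∀ m, m < t → ∀ v, G.Adj (l (C m)) v → v = P m

/-- The embedding of the clipped display graph. -/
noncomputable def dispMap {V1 V2 W1 W2 X Y : Type*} (l1 : X → V1) (l2 : X → V2) (l1' : Y → W1)
    (l2' : Y → W2) (φ1 : W1 → V1) (φ2 : W2 → V2) (A : DisplayVertex l1' l2') :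
    DisplayVertex l1 l2 :=
  toDisplay l1 l2 (Sum.map φ1 φ2 A.1)

lemma ladder_of_halves {V1 V2 W1 W2 X Y : Type*} {G1 : SimpleGraph V1} {l1 : X → V1}
    {G1' : SimpleGraph W1} {l1' : Y → W1} {G2 : SimpleGraph V2} {l2 : X → V2}
    {G2' : SimpleGraph W2} {l2' : Y → W2} {ι : Y → X} {φ1 : W1 → V1} {φ2 : W2 → V2}
    {C : ℕ → X} {P : ℕ → V1} {Q : ℕ → V2} {t L r : ℕ}
    (H1 : Half G1 l1 G1' l1' ι φ1 C P t L r) (H2 : Half G2 l2 G2' l2' ι φ2 C Q t L r)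
    (hL : 0 < L) (hLr : L ≤ r) (hr : r < t)
    (Cinj : ∀ m n, m < t → n < t → C m = C n → m = n)
    (kept : ∀ x, (∀ m, L ≤ m → m < r → C m ≠ x) → ∃ y, ι y = x) :
    Ladder (displayGraph G1 l1 G2 l2) (displayGraph G1' l1' G2' l2')
      (dispMap l1 l2 l1' l2' φ1 φ2) (fun m => toDisplay l1 l2 (Sum.inl (P m)))
      (fun m => toDisplay l1 l2 (Sum.inr (Q m))) (fun m => toDisplay l1 l2 (Sum.inl (l1 (C m))))
      t L r := by
  have tdl := fun x => td_leaf (l1 := l1) H2.linj x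
  have tdl' := fun x => td_leaf (l1 := l1') H2.linj' x
  have Fl : ∀ u, dispMap l1 l2 l1' l2' φ1 φ2 (toDisplay l1' l2' (Sum.inl u)) =
      toDisplay l1 l2 (Sum.inl (φ1 u)) := fun u => rfl
  have Fr : ∀ u, dispMap l1 l2 l1' l2' φ1 φ2 (toDisplay l1' l2' (Sum.inr u)) =
      toDisplay l1 l2 (Sum.inr (φ2 u)) := by
    intro u
    by_cases hu : ∃ y, l2' y = u
    · obtain ⟨y, rfl⟩ := hu
      rw [tdl', Fl, H1.fl, H2.fl, tdl]
    · push Not at hu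
      have e : toDisplay l1' l2' (Sum.inr u) = ⟨Sum.inr u, merge_nonleaf hu⟩ :=
        Subtype.ext (merge_nonleaf hu)
      rw [e]
      rfl
  have surj' : ∀ A : DisplayVertex l1' l2', (∃ u, A = toDisplay l1' l2' (Sum.inl u)) ∨
      (∃ u, A = toDisplay l1' l2' (Sum.inr u)) := by
    intro A
    have := td_surj A
    rcases h : A.1 with u | u
    · exact Or.inl ⟨u, by rw [← h, this]⟩
    · exact Or.inr ⟨u, by rw [← h, this]⟩
  have surj : ∀ A : DisplayVertex l1 l2, (∃ u, A = toDisplay l1 l2 (Sum.inl u)) ∨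
      (∃ u, A = toDisplay l1 l2 (Sum.inr u)) := by
    intro A
    have := td_surj A
    rcases h : A.1 with u | u
    · exact Or.inl ⟨u, by rw [← h, this]⟩
    · exact Or.inr ⟨u, by rw [← h, this]⟩
  have kept1 : ∀ u x, φ1 u = l1 x → ∃ y, ι y = x ∧ u = l1' y := by
    intro u x h
    obtain ⟨y, rfl⟩ := kept x (fun m h1 h2 h3 => by
      have := ((H1.range (φ1 u)).mp ⟨u, rfl⟩ m h1 h2).1
      exact this (by rw [h, h3]))
    exact ⟨y, rfl, H1.finj (h.trans (H1.fl y).symm)⟩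
  have kept2 : ∀ u x, φ2 u = l2 x → ∃ y, ι y = x ∧ u = l2' y := by
    intro u x h
    obtain ⟨y, rfl⟩ := kept x (fun m h1 h2 h3 => by
      have := ((H2.range (φ2 u)).mp ⟨u, rfl⟩ m h1 h2).1
      exact this (by rw [h, h3]))
    exact ⟨y, rfl, H2.finj (h.trans (H2.fl y).symm)⟩
  have liftl : ∀ A u, dispMap l1 l2 l1' l2' φ1 φ2 A = toDisplay l1 l2 (Sum.inl u) →
      ∃ u', A = toDisplay l1' l2' (Sum.inl u') ∧ φ1 u' = u := by
    intro A u h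
    rcases surj' A with ⟨v, rfl⟩ | ⟨v, rfl⟩
    · exact ⟨v, rfl, td_inl_inj h⟩
    · rw [Fr] at h
      obtain ⟨x, rfl, h4⟩ := td_inl_inr H2.linj h.symm
      obtain ⟨y, rfl, rfl⟩ := kept2 v x h4
      exact ⟨l1' y, tdl' y, H1.fl y⟩
  have liftr : ∀ A u, dispMap l1 l2 l1' l2' φ1 φ2 A = toDisplay l1 l2 (Sum.inr u) →
      ∃ u', A = toDisplay l1' l2' (Sum.inr u') ∧ φ2 u' = u := by
    intro A u h
    rcases surj' A with ⟨v, rfl⟩ | ⟨v, rfl⟩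
    · rw [Fl] at h
      obtain ⟨x, h4, rfl⟩ := td_inl_inr H2.linj h
      obtain ⟨y, rfl, rfl⟩ := kept1 v x h4
      exact ⟨l2' y, (tdl' y).symm, H2.fl y⟩
    · rw [Fr] at h
      exact ⟨v, rfl, td_inr_inj H1.linj H2.linj h⟩
  have hab : ∀ u m, m < t → toDisplay l1 l2 (Sum.inl u) ≠ toDisplay l1 l2 (Sum.inr (Q m)) := by
    intro u m hm h
    obtain ⟨x, -, h⟩ := td_inl_inr H2.linj h
    exact H2.Pnl m hm x h.symm
  have hba : ∀ u m, m < t → toDisplay l1 l2 (Sum.inl (P m)) ≠ toDisplay l1 l2 (Sum.inr u) := by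
    intro u m hm h
    obtain ⟨x, h, -⟩ := td_inl_inr H2.linj h
    exact H1.Pnl m hm x h.symm
  have DA := display_adj H1.linj H2.linj G1 G2
  have DA' := display_adj H1.linj' H2.linj' G1' G2'
  refine ⟨hL, hLr, hr, ?_, ?_, ?_, ?_, ?_, ?_, ?_, ?_, ?_, ?_, ?_, ?_, ?_, ?_, ?_, ?_, ?_, ?_, ?_⟩
  · -- injectivity
    intro A B h0
    rcases surj' B with ⟨v, rfl⟩ | ⟨v, rfl⟩
    · obtain ⟨u, rfl, h⟩ := liftl A _ (h0.trans (Fl v))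
      rw [H1.finj h]
    · obtain ⟨u, rfl, h⟩ := liftr A _ (h0.trans (Fr v))
      rw [H2.finj h]
  · -- range
    intro v
    constructor
    · rintro ⟨A, rfl⟩ m h1 h2
      rcases surj' A with ⟨u, rfl⟩ | ⟨u, rfl⟩
      · have := (H1.range (φ1 u)).mp ⟨u, rfl⟩ m h1 h2
        rw [Fl]
        exact ⟨fun h => this.2 (td_inl_inj h).symm, hab _ _ (by omega),
          fun h => this.1 (td_inl_inj h).symm⟩
      · have := (H2.range (φ2 u)).mp ⟨u, rfl⟩ m h1 h2
        rw [Fr]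
        refine ⟨(hba _ _ (by omega)).symm, fun h => this.2 (td_inr_inj H1.linj H2.linj h).symm, ?_⟩
        rw [← tdl]
        exact fun h => this.1 (td_inr_inj H1.linj H2.linj h).symm
    · intro h
      rcases surj v with ⟨u, rfl⟩ | ⟨u, rfl⟩
      · obtain ⟨u', rfl⟩ := (H1.range u).mpr (fun m h1 h2 =>
          ⟨fun e => (h m h1 h2).2.2 (by rw [e]), fun e => (h m h1 h2).1 (by rw [e])⟩)
        exact ⟨_, Fl u'⟩
      · obtain ⟨u', rfl⟩ := (H2.range u).mpr (fun m h1 h2 =>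
          ⟨fun e => (h m h1 h2).2.2 (by rw [← tdl, e]), fun e => (h m h1 h2).2.1 (by rw [e])⟩)
        exact ⟨_, Fr u'⟩
  · -- adjacency
    intro x y h0
    rcases (DA _ _).mp h0 with ⟨u, v, h, hx, hy⟩ | ⟨u, v, h, hx, hy⟩
    · obtain ⟨x', rfl, rfl⟩ := liftl x u hx
      obtain ⟨y', rfl, rfl⟩ := liftl y v hy
      exact (DA' _ _).mpr (Or.inl ⟨x', y', (H1.adj _ _).mpr (Or.inl h), rfl, rfl⟩)
    · obtain ⟨x', rfl, rfl⟩ := liftr x u hx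
      obtain ⟨y', rfl, rfl⟩ := liftr y v hy
      exact (DA' _ _).mpr (Or.inr ⟨x', y', (H2.adj _ _).mpr (Or.inl h), rfl, rfl⟩)
  · intro x y hx hy
    obtain ⟨x', rfl, hx'⟩ := liftl x _ hx
    obtain ⟨y', rfl, hy'⟩ := liftl y _ hy
    exact (DA' _ _).mpr (Or.inl ⟨x', y', (H1.adj _ _).mpr (Or.inr (Or.inl ⟨hx', hy'⟩)), rfl, rfl⟩)
  · intro x y hx hy
    obtain ⟨x', rfl, hx'⟩ := liftr x _ hx
    obtain ⟨y', rfl, hy'⟩ := liftr y _ hy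
    exact (DA' _ _).mpr (Or.inr ⟨x', y', (H2.adj _ _).mpr (Or.inr (Or.inl ⟨hx', hy'⟩)), rfl, rfl⟩)
  · intro x y h0
    rcases (DA' _ _).mp h0 with ⟨u, v, h, rfl, rfl⟩ | ⟨u, v, h, rfl, rfl⟩
    · rw [Fl, Fl]
      rcases (H1.adj _ _).mp h with h | ⟨h1, h2⟩ | ⟨h1, h2⟩
      · exact Or.inl ((DA _ _).mpr (Or.inl ⟨_, _, h, rfl, rfl⟩))
      · exact Or.inr (Or.inl ⟨by rw [h1], by rw [h2]⟩)
      · exact Or.inr (Or.inr (Or.inl ⟨by rw [h1], by rw [h2]⟩))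
    · rw [Fr, Fr]
      rcases (H2.adj _ _).mp h with h | ⟨h1, h2⟩ | ⟨h1, h2⟩
      · exact Or.inl ((DA _ _).mpr (Or.inr ⟨_, _, h, rfl, rfl⟩))
      · exact Or.inr (Or.inr (Or.inr (Or.inl ⟨by rw [h1], by rw [h2]⟩)))
      · exact Or.inr (Or.inr (Or.inr (Or.inr ⟨by rw [h1], by rw [h2]⟩)))
  · exact fun m n hm hn h => H1.Pinj m n hm hn (td_inl_inj h)
  · exact fun m n hm hn h => H2.Pinj m n hm hn (td_inr_inj H1.linj H2.linj h)
  · exact fun m n hm hn h => Cinj m n hm hn (H1.linj (td_inl_inj h))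
  · exact fun m n hm hn => hab _ _ hn
  · exact fun m n hm hn h => H1.Pnl m hm _ (td_inl_inj h).symm
  · exact fun m n hm hn => (hab _ _ hm).symm
  · exact fun m hm => (DA _ _).mpr (Or.inl ⟨_, _, H1.adjP m hm, rfl, rfl⟩)
  · exact fun m hm => (DA _ _).mpr (Or.inr ⟨_, _, H2.adjP m hm, rfl, rfl⟩)
  · exact fun m hm => (DA _ _).mpr (Or.inl ⟨_, _, H1.adjC m hm, rfl, rfl⟩)
  · exact fun m hm => (DA _ _).mpr (Or.inr ⟨_, _, H2.adjC m hm, rfl, (tdl _).symm⟩)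
  · intro m hm v h0
    rcases (DA _ _).mp h0 with ⟨u, v, h, h1, rfl⟩ | ⟨u, v, h, h1, rfl⟩
    · rw [← td_inl_inj h1] at h
      rcases H1.nbP m hm v h with rfl | rfl | rfl
      · exact Or.inl rfl
      · exact Or.inr (Or.inl rfl)
      · exact Or.inr (Or.inr rfl)
    · exact absurd h1 (hba _ _ (by omega))
  · intro m hm v h0
    rcases (DA _ _).mp h0 with ⟨u, v, h, h1, rfl⟩ | ⟨u, v, h, h1, rfl⟩
    · exact absurd h1.symm (hab _ _ (by omega))
    · rw [← td_inr_inj H1.linj H2.linj h1] at h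
      rcases H2.nbP m hm v h with rfl | rfl | rfl
      · exact Or.inl rfl
      · exact Or.inr (Or.inl rfl)
      · exact Or.inr (Or.inr (tdl _))
  · intro m hm v h0
    rcases (DA _ _).mp h0 with ⟨u, v, h, h1, rfl⟩ | ⟨u, v, h, h1, rfl⟩
    · rw [← td_inl_inj h1] at h
      rw [H1.nbC m hm v h]
      exact Or.inl rfl
    · rw [← tdl] at h1
      rw [← td_inr_inj H1.linj H2.linj h1] at h
      rw [H2.nbC m hm v h]
      exact Or.inr rfl

lemma leaf_nb {V X : Type*} (T : PhyloTree V X) (x : X) {u v : V} (hu : T.graph.Adj (T.leaf x) u)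
    (hv : T.graph.Adj (T.leaf x) v) : u = v := by
  obtain ⟨z, hz⟩ := Set.ncard_eq_one.mp (T.leaf_deg x)
  have h1 : u ∈ T.graph.neighborSet (T.leaf x) := hu
  have h2 : v ∈ T.graph.neighborSet (T.leaf x) := hv
  rw [hz] at h1 h2
  exact h1.trans h2.symm

lemma half_of_chain {V W X : Type*} (T : PhyloTree V X) (t k : ℕ) (ht : 2 * k + 2 < t)
    (c : Fin t → X) (p : Fin t → V)
    (hch : PhyloChain T t c p)
    (T' : PhyloTree W {x : X // ∀ i : Fin t, ¬ keepIdx t (2 * k + 2) i → c i ≠ x})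
    (hcl : IsClippedChain T t c p (2 * k + 2) T') :
    ∃ φ : W → V, Half T.graph T.leaf T'.graph T'.leaf Subtype.val φ
      (fun m => c ⟨m % t, Nat.mod_lt _ (by omega)⟩) (fun m => p ⟨m % t, Nat.mod_lt _ (by omega)⟩)
      t (k + 1) (t - (k + 1)) := by
  obtain ⟨φ, finj, fl, hrange, hadj⟩ := hcl
  obtain ⟨cinj, pinj, hpc, hpp⟩ := hch
  set C : ℕ → X := fun m => c ⟨m % t, Nat.mod_lt _ (by omega)⟩ with hC
  set P : ℕ → V := fun m => p ⟨m % t, Nat.mod_lt _ (by omega)⟩ with hP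
  have Pc : ∀ (m : ℕ) (h : m < t), P m = p ⟨m, h⟩ := by
    intro m h
    simp only [hP, Nat.mod_eq_of_lt h]
  have Cc : ∀ (m : ℕ) (h : m < t), C m = c ⟨m, h⟩ := by
    intro m h
    simp only [hC, Nat.mod_eq_of_lt h]
  have Pinj : ∀ m n, m < t → n < t → P m = P n → m = n := by
    intro m n hm hn h
    rw [Pc m hm, Pc n hn] at h
    exact congrArg Fin.val (pinj h)
  have adjP : ∀ m, m + 1 < t → T.graph.Adj (P m) (P (m + 1)) := by
    intro m hm
    rw [Pc m (by omega), Pc (m + 1) hm]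
    exact hpp m hm
  have adjC : ∀ m, m < t → T.graph.Adj (P m) (T.leaf (C m)) := by
    intro m hm
    rw [Pc m hm, Cc m hm]
    exact hpc _
  have Pnl1 : ∀ m, m + 2 < t → ∀ x, T.leaf x ≠ P (m + 1) := by
    intro m hm x hx
    have h1 := (adjP m (by omega)).symm
    have h2 := adjP (m + 1) (by omega)
    rw [← hx] at h1 h2
    have := Pinj _ _ (by omega) (by omega) (leaf_nb T x h1 h2)
    omega
  have Pnl : ∀ m, m < t → ∀ x, T.leaf x ≠ P m := by
    intro m hm x hx
    have h0 := adjC m hm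
    rw [← hx] at h0
    by_cases hm0 : m = 0
    · subst hm0
      have h1 := adjP 0 (by omega)
      rw [← hx] at h1
      exact Pnl1 0 (by omega) _ (leaf_nb T x h0 h1)
    · by_cases hmt : m + 1 < t
      · obtain ⟨n, rfl⟩ : ∃ n, m = n + 1 := ⟨m - 1, by omega⟩
        exact Pnl1 n (by omega) x hx
      · obtain ⟨n, rfl⟩ : ∃ n, m = n + 1 + 1 := ⟨m - 2, by omega⟩
        have h1 := (adjP (n + 1) (by omega)).symm
        rw [← hx] at h1
        exact Pnl1 n (by omega) _ (leaf_nb T x h0 h1)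
  have keep : ∀ i : Fin t, ¬ keepIdx t (2 * k + 2) i ↔ k + 1 ≤ (i : ℕ) ∧ (i : ℕ) < t - (k + 1) := by
    intro i
    unfold keepIdx
    omega
  have e1 : (2 * k + 2 + 1) / 2 - 1 = k + 1 - 1 := by omega
  have e2 : t - (2 * k + 2) / 2 = t - (k + 1) := by omega
  refine ⟨φ, T.leaf_inj, T'.leaf_inj, finj, fl, ?_, ?_, Pinj, Pnl, adjP, adjC, ?_, ?_⟩
  · intro v
    have : (∃ w, φ w = v) ↔ v ∈ Set.range φ := Iff.rfl
    rw [this, hrange]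
    constructor
    · intro h m h1 h2
      have := h ⟨m, by omega⟩ ((keep _).mpr ⟨h1, h2⟩)
      rw [Pc m (by omega), Cc m (by omega)]
      exact this
    · intro h i hi
      obtain ⟨h1, h2⟩ := (keep i).mp hi
      have := h i h1 h2
      rw [Pc i i.2, Cc i i.2] at this
      exact this
  · intro u v
    rw [hadj]
    have q1 : ∀ h, p ⟨(2 * k + 2 + 1) / 2 - 1, h⟩ = P (k + 1 - 1) := by
      intro h
      rw [Pc _ (by omega)]
      congr 2
    have q2 : ∀ h, p ⟨t - (2 * k + 2) / 2, h⟩ = P (t - (k + 1)) := by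
      intro h
      rw [Pc _ (by omega)]
      congr 2
    simp only [q1, q2]
    constructor
    · rintro (h | ⟨_, _, h⟩)
      · exact Or.inl h
      · exact Or.inr h
    · rintro (h | h)
      · exact Or.inl h
      · exact Or.inr ⟨by omega, by omega, h⟩
  · intro m hm v hv
    have h3 := T.internal_deg (P (m + 1)) (Pnl _ (by omega))
    have hfin : (T.graph.neighborSet (P (m + 1))).Finite :=
      Set.finite_of_ncard_ne_zero (by omega)
    have hsub : ({P m, P (m + 2), T.leaf (C (m + 1))} : Set V) ⊆
        T.graph.neighborSet (P (m + 1)) := by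
      rintro z (rfl | rfl | rfl)
      · exact (adjP m (by omega)).symm
      · exact adjP (m + 1) (by omega)
      · exact adjC (m + 1) (by omega)
    have hcard : ({P m, P (m + 2), T.leaf (C (m + 1))} : Set V).ncard = 3 := by
      rw [Set.ncard_eq_three]
      refine ⟨_, _, _, ?_, ?_, ?_, rfl⟩
      · intro h
        have := Pinj _ _ (by omega) (by omega) h; omega
      · exact (Pnl _ (by omega) _).symm
      · exact (Pnl _ (by omega) _).symm
    have heq := Set.eq_of_subset_of_ncard_le hsub (by omega) hfin
    have hv' : v ∈ T.graph.neighborSet (P (m + 1)) := hv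
    rw [← heq] at hv'
    exact hv'
  · intro m hm v hv
    exact leaf_nb T (C m) hv (adjC m hm).symm

lemma hasTD_nonempty {V : Type*} [Finite V] (G : SimpleGraph V) :
    {k | HasTreeDecompWidthLE G k}.Nonempty := by
  have := Fintype.ofFinite V
  refine ⟨Fintype.card V, (hasTD_iff G _).mpr ⟨{Finset.univ}, Dec.single _ (by simp), ?_, ?_⟩⟩
  · exact fun v => ⟨_, rfl, Finset.mem_univ v⟩
  · exact fun u v _ => ⟨_, rfl, Finset.mem_univ u, Finset.mem_univ v⟩

lemma display_finite {V1 V2 X : Type*} (l1 : X → V1) (l2 : X → V2) (h1 : Finite V1)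
    (h2 : Finite V2) : Finite (DisplayVertex l1 l2) := by
  unfold DisplayVertex
  infer_instance

end PhyloSection

/-- There is a function `f : ℕ → ℕ` such that for any two incompatible unrooted
binary phylogenetic trees `T1, T2` whose display graph has treewidth `k`, if
`T1` and `T2` have a common chain of length `t > f k`, then clipping the chain
down to length `f k` (by the common chain reduction) preserves the treewidth of
the display graph. -/
theorem dtw_chain_clip_function :
    ∃ f : ℕ → ℕ, ∀ (V1 V2 X W1 W2 : Type) (T1 : PhyloTree V1 X) (T2 : PhyloTree V2 X),
      ¬ Compatible T1 T2 →
      ∀ k : ℕ, treewidth (displayGraph T1.graph T1.leaf T2.graph T2.leaf) = k →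
      ∀ (t : ℕ) (c : Fin t → X) (p : Fin t → V1) (q : Fin t → V2),
        PhyloChain T1 t c p → PhyloChain T2 t c q → f k < t →
        ∀ (T1' : PhyloTree W1 {x : X // ∀ i : Fin t, ¬ keepIdx t (f k) i → c i ≠ x})
          (T2' : PhyloTree W2 {x : X // ∀ i : Fin t, ¬ keepIdx t (f k) i → c i ≠ x}),
          IsClippedChain T1 t c p (f k) T1' → IsClippedChain T2 t c q (f k) T2' →
          treewidth (displayGraph T1'.graph T1'.leaf T2'.graph T2'.leaf) = k := by
  refine ⟨fun k => 2 * k + 2, ?_⟩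
  intro V1 V2 X W1 W2 T1 T2 _ k hk t c p q hp hq ht T1' T2' hc1 hc2
  simp only at ht hc1 hc2 T1' T2' ⊢
  obtain ⟨φ1, H1⟩ := half_of_chain T1 t k ht c p hp T1' hc1
  obtain ⟨φ2, H2⟩ := half_of_chain T2 t k ht c q hq T2' hc2
  have cinj := hp.1
  have H := ladder_of_halves H1 H2 (by omega) (by omega) (by omega)
    (by
      intro m n hm hn h
      have := congrArg Fin.val (cinj h)
      simpa [Nat.mod_eq_of_lt hm, Nat.mod_eq_of_lt hn] using this)
    (by
      intro x hx
      refine ⟨⟨x, ?_⟩, rfl⟩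
      intro i hi
      have hi' : k + 1 ≤ (i : ℕ) ∧ (i : ℕ) < t - (k + 1) := by
        unfold keepIdx at hi
        omega
      have := hx i hi'.1 hi'.2
      simpa [Nat.mod_eq_of_lt i.2] using this)
  have f1 := display_finite T1.leaf T2.leaf T1.finite T2.finite
  have f2 := display_finite T1'.leaf T2'.leaf T1'.finite T2'.finite
  have hD := Nat.sInf_mem (hasTD_nonempty (displayGraph T1.graph T1.leaf T2.graph T2.leaf))
  have hD' := Nat.sInf_mem (hasTD_nonempty (displayGraph T1'.graph T1'.leaf T2'.graph T2'.leaf))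
  change HasTreeDecompWidthLE _ (treewidth _) at hD hD'
  have hle : treewidth (displayGraph T1'.graph T1'.leaf T2'.graph T2'.leaf) ≤ k := by
    rw [hk] at hD
    exact Nat.sInf_le (H.clip_le k hD)
  refine le_antisymm hle ?_
  by_contra hlt
  push Not at hlt
  have h3 := H.extend _ (by omega) (by omega) hD'
  have h4 : treewidth (displayGraph T1.graph T1.leaf T2.graph T2.leaf) ≤
      treewidth (displayGraph T1'.graph T1'.leaf T2'.graph T2'.leaf) := Nat.sInf_le h3
  omega
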